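/- arXiv:1208.0283 — 12 statements merged into one kernel-verified Lean document; each statement's English description precedes it below -/
import Mathlib

section
/- Let P = (p_1, …, p_n) be a probability distribution with p_1 ≥ p_2 ≥ … ≥ p_n ≥ 0. Let 1 ≤ i < j ≤ n and let ε be a real with 0 < ε ≤ p_j. Define Q = (p_1, …, p_i + ε, …, p_j − ε, …, p_n) (i.e., Q agrees with P except that the i-th entry is increased by ε and the j-th entry is decreased by ε). Then for every real λ > 0 with λ ≠ 1, H_λ(P) > H_λ(Q). -/
/-- A strictly convex function gains from spreading two points apart symmetrically. -/
theorem StrictConvexOn.add_lt_add_of_spread {s : Set ℝ} {f : ℝ → ℝ} (hf : StrictConvexOn ℝ s f)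
    {a b ε : ℝ} (hb : b - ε ∈ s) (ha : a + ε ∈ s) (hba : b ≤ a) (hε : 0 < ε) :
    f a + f b < f (a + ε) + f (b - ε) := by
  have hd : 0 < a - b + 2 * ε := by linarith
  set t := ε / (a - b + 2 * ε) with ht
  have htε : t * (a - b + 2 * ε) = ε := div_mul_cancel₀ _ hd.ne'
  have ht0 : 0 < t := div_pos hε hd
  have ht1 : 0 < 1 - t := by
    rw [sub_pos, ht, div_lt_one hd]
    linarith
  have hne : b - ε ≠ a + ε := by linarith
  have h₁ := hf.2 hb ha hne ht1 ht0 (by ring)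
  have h₂ := hf.2 hb ha hne ht0 ht1 (by ring)
  simp only [smul_eq_mul] at h₁ h₂
  rw [show (1 - t) * (b - ε) + t * (a + ε) = b by linear_combination htε] at h₁
  rw [show t * (b - ε) + (1 - t) * (a + ε) = a by linear_combination -htε] at h₂
  linarith

/-- The effect on `∑ k, f (p k)` of overwriting two distinct entries of `p`. -/
theorem sum_comp_update_update {ι : Type*} [Fintype ι] [DecidableEq ι] (f : ℝ → ℝ) (p : ι → ℝ)
    {i j : ι} (hij : i ≠ j) (x y : ℝ) :
    ∑ k, f (Function.update (Function.update p i x) j y k) =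
      ∑ k, f (p k) + (f x + f y - (f (p i) + f (p j))) := by
  have hj : j ∈ Finset.univ.erase i := by simp [hij.symm]
  rw [← Finset.add_sum_erase _ _ (Finset.mem_univ i), ← Finset.add_sum_erase _ _ hj,
    ← Finset.add_sum_erase Finset.univ (fun k => f (p k)) (Finset.mem_univ i),
    ← Finset.add_sum_erase _ (fun k => f (p k)) hj]
  have hrest : ∑ k ∈ (Finset.univ.erase i).erase j,
        f (Function.update (Function.update p i x) j y k) =
      ∑ k ∈ (Finset.univ.erase i).erase j, f (p k) := by
    refine Finset.sum_congr rfl fun k hk => ?_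
    simp only [Finset.mem_erase] at hk
    rw [Function.update_of_ne hk.1, Function.update_of_ne hk.2.1]
  rw [hrest, Function.update_of_ne hij, Function.update_self, Function.update_self]
  ring


/-- Stochastic domination lowers Rényi entropy: if `P` is sorted nonincreasingly
and we move mass `ε` from the `j`-th entry to the `i`-th entry (`i < j`),
then the Rényi entropy of order `λ` strictly decreases. -/
theorem renyi_entropy_lt_of_transfer (n : ℕ) (p : Fin n → ℝ)
    (hsorted : ∀ i j : Fin n, i ≤ j → p j ≤ p i)
    (hnonneg : ∀ i, 0 ≤ p i) (hsum : ∑ i, p i = 1)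
    (i j : Fin n) (hij : i < j) (ε : ℝ) (hε : 0 < ε) (hεj : ε ≤ p j)
    (lam : ℝ) (hlam : 0 < lam) (hlam1 : lam ≠ 1)
    (q : Fin n → ℝ)
    (hq : q = Function.update (Function.update p i (p i + ε)) j (p j - ε)) :
    (1 / (1 - lam)) * Real.logb 2 (∑ k, q k ^ lam) <
      (1 / (1 - lam)) * Real.logb 2 (∑ k, p k ^ lam) := by
  subst hq
  have hji : p j ≤ p i := hsorted i j hij.le
  have hpi : 0 < p i := by linarith
  have hb : p j - ε ∈ Set.Ici (0 : ℝ) := by simpa using hεj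
  have ha : p i + ε ∈ Set.Ici (0 : ℝ) := by
    rw [Set.mem_Ici]
    linarith
  have hP : 0 < ∑ k, p k ^ lam :=
    Finset.sum_pos' (fun k _ => Real.rpow_nonneg (hnonneg k) _)
      ⟨i, Finset.mem_univ i, Real.rpow_pos_of_pos hpi _⟩
  have hQ : 0 < ∑ k, Function.update (Function.update p i (p i + ε)) j (p j - ε) k ^ lam := by
    refine Finset.sum_pos' (fun k _ => Real.rpow_nonneg ?_ _)
      ⟨i, Finset.mem_univ i, Real.rpow_pos_of_pos ?_ _⟩
    · rcases eq_or_ne k j with rfl | hkj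
      · simpa using hεj
      · rw [Function.update_of_ne hkj]
        rcases eq_or_ne k i with rfl | hki
        · simpa using ha
        · rw [Function.update_of_ne hki]
          exact hnonneg k
    · rw [Function.update_of_ne hij.ne, Function.update_self]
      linarith
  have hsums := sum_comp_update_update (fun x : ℝ => x ^ lam) p hij.ne (p i + ε) (p j - ε)
  rcases hlam1.lt_or_gt with hlt | hgt
  · have h := (Real.strictConcaveOn_rpow hlam hlt).neg.add_lt_add_of_spread hb ha hji hε
    simp only [Pi.neg_apply] at h
    refine mul_lt_mul_of_pos_left (Real.logb_lt_logb one_lt_two hQ ?_)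
      (one_div_pos.mpr (sub_pos.mpr hlt))
    linarith
  · have h := (strictConvexOn_rpow hgt).add_lt_add_of_spread hb ha hji hε
    refine mul_lt_mul_of_neg_left (Real.logb_lt_logb one_lt_two hP ?_)
      (one_div_neg.mpr (sub_neg.mpr hgt))
    linarith
end

section
/- Let P = (p_1, …, p_n) and Q = (q_1, …, q_n) be probability distributions on {1, …, n} with all q_i > 0, and let λ > 0 with λ ≠ 1. Then the discrete Rényi relative entropy of order λ is nonnegative: h_λ[P,Q] = (1/(1−λ))·log₂(Σ_i q_i^{λ−1}·p_i) + (1/λ)·log₂(Σ_i q_i^λ) − (1/(λ(1−λ)))·log₂(Σ_i p_i^λ) ≥ 0. -/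
open Finset in
/-- Hölder's inequality comparing `∑ q ^ (r - 1) * p` with power sums of order `r > 1`. -/
lemma sum_rpow_sub_one_mul_le {ι : Type*} (s : Finset ι) {r : ℝ} (hr : 1 < r) {p q : ι → ℝ}
    (hp : ∀ i ∈ s, 0 ≤ p i) (hq : ∀ i ∈ s, 0 < q i) :
    ∑ i ∈ s, q i ^ (r - 1) * p i ≤
      (∑ i ∈ s, p i ^ r) ^ (1 / r) * (∑ i ∈ s, q i ^ r) ^ ((r - 1) / r) := by
  have hr0 : r ≠ 0 := by positivity
  have hr1 : r - 1 ≠ 0 := by linarith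
  have hc : r.HolderConjugate (r / (r - 1)) :=
    Real.holderConjugate_iff.2 ⟨hr, by field_simp; ring⟩
  have h := Real.inner_le_Lp_mul_Lq_of_nonneg s hc hp
    (g := fun i ↦ q i ^ (r - 1)) fun i hi ↦ (Real.rpow_pos_of_pos (hq i hi) _).le
  have hpow : ∀ i ∈ s, (q i ^ (r - 1)) ^ (r / (r - 1)) = q i ^ r := fun i hi ↦ by
    rw [← Real.rpow_mul (hq i hi).le]
    congr 1
    field_simp
  rw [sum_congr rfl hpow, one_div_div] at h
  simpa only [mul_comm] using h

open Finset in
/-- Hölder's inequality comparing `∑ q ^ (r - 1) * p` with power sums of order `0 < r < 1`. -/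
lemma sum_rpow_le_sum_rpow_sub_one_mul {ι : Type*} (s : Finset ι) {r : ℝ} (hr0 : 0 < r)
    (hr1 : r < 1) {p q : ι → ℝ} (hp : ∀ i ∈ s, 0 ≤ p i) (hq : ∀ i ∈ s, 0 < q i) :
    ∑ i ∈ s, p i ^ r ≤
      (∑ i ∈ s, q i ^ (r - 1) * p i) ^ r * (∑ i ∈ s, q i ^ r) ^ (1 - r) := by
  have hr' : 1 - r ≠ 0 := by linarith
  have hc : (1 / r).HolderConjugate (1 / (1 - r)) :=
    Real.holderConjugate_iff.2 ⟨(one_lt_div hr0).2 hr1, by simp⟩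
  have hA : ∀ i ∈ s, 0 ≤ q i ^ (r - 1) * p i := fun i hi ↦
    mul_nonneg (Real.rpow_pos_of_pos (hq i hi) _).le (hp i hi)
  have h := Real.inner_le_Lp_mul_Lq_of_nonneg s hc
    (f := fun i ↦ (q i ^ (r - 1) * p i) ^ r) (g := fun i ↦ q i ^ (r * (1 - r)))
    (fun i hi ↦ Real.rpow_nonneg (hA i hi) _)
    fun i hi ↦ (Real.rpow_pos_of_pos (hq i hi) _).le
  have hprod : ∀ i ∈ s, (q i ^ (r - 1) * p i) ^ r * q i ^ (r * (1 - r)) = p i ^ r :=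
    fun i hi ↦ by
      rw [Real.mul_rpow (Real.rpow_pos_of_pos (hq i hi) _).le (hp i hi),
        ← Real.rpow_mul (hq i hi).le, mul_right_comm, ← Real.rpow_add (hq i hi),
        show (r - 1) * r + r * (1 - r) = 0 by ring, Real.rpow_zero, one_mul]
  have hf : ∀ i ∈ s, ((q i ^ (r - 1) * p i) ^ r) ^ (1 / r) = q i ^ (r - 1) * p i :=
    fun i hi ↦ by
      rw [← Real.rpow_mul (hA i hi), mul_one_div_cancel hr0.ne', Real.rpow_one]
  have hg : ∀ i ∈ s, (q i ^ (r * (1 - r))) ^ (1 / (1 - r)) = q i ^ r := fun i hi ↦ by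
    rw [← Real.rpow_mul (hq i hi).le, mul_assoc, mul_one_div_cancel hr', mul_one]
  rwa [sum_congr rfl hprod, sum_congr rfl hf, sum_congr rfl hg, one_div_one_div,
    one_div_one_div] at h

/-- Nonnegativity of the discrete Rényi relative entropy of order `λ`
(discrete Gibbs inequality). -/
theorem renyi_relative_entropy_nonneg (n : ℕ) (lam : ℝ)
    (hlam0 : 0 < lam) (hlam1 : lam ≠ 1)
    (p q : Fin n → ℝ)
    (hp : ∀ i, 0 ≤ p i) (hpsum : ∑ i, p i = 1)
    (hq : ∀ i, 0 < q i) (hqsum : ∑ i, q i = 1) :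
    0 ≤ (1 / (1 - lam)) * Real.logb 2 (∑ i, q i ^ (lam - 1) * p i)
        + (1 / lam) * Real.logb 2 (∑ i, q i ^ lam)
        - (1 / (lam * (1 - lam))) * Real.logb 2 (∑ i, p i ^ lam) := by
  obtain ⟨j, -, hj⟩ : ∃ j ∈ Finset.univ, 0 < p j :=
    (Finset.sum_pos_iff_of_nonneg fun i _ ↦ hp i).1 (hpsum ▸ one_pos)
  have hA : 0 < ∑ i, q i ^ (lam - 1) * p i :=
    Finset.sum_pos' (fun i _ ↦ mul_nonneg (Real.rpow_pos_of_pos (hq i) _).le (hp i))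
      ⟨j, Finset.mem_univ j, mul_pos (Real.rpow_pos_of_pos (hq j) _) hj⟩
  have hB : 0 < ∑ i, q i ^ lam :=
    Finset.sum_pos (fun i _ ↦ Real.rpow_pos_of_pos (hq i) _) ⟨j, Finset.mem_univ j⟩
  have hC : 0 < ∑ i, p i ^ lam :=
    Finset.sum_pos' (fun i _ ↦ Real.rpow_nonneg (hp i) _)
      ⟨j, Finset.mem_univ j, Real.rpow_pos_of_pos hj _⟩
  have hne : 1 - lam ≠ 0 := sub_ne_zero.2 hlam1.symm
  rcases hlam1.lt_or_gt with hlt | hgt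
  · have h := Real.logb_le_logb_of_le one_lt_two hC
      (sum_rpow_le_sum_rpow_sub_one_mul Finset.univ hlam0 hlt (fun i _ ↦ hp i) fun i _ ↦ hq i)
    rw [Real.logb_mul (Real.rpow_pos_of_pos hA _).ne' (Real.rpow_pos_of_pos hB _).ne',
      Real.logb_rpow_eq_mul_logb_of_pos hA, Real.logb_rpow_eq_mul_logb_of_pos hB] at h
    have h' := div_nonneg (sub_nonneg.2 h) (mul_pos hlam0 (sub_pos.2 hlt)).le
    refine h'.trans_eq ?_
    field_simp
  · have h := Real.logb_le_logb_of_le one_lt_two hA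
      (sum_rpow_sub_one_mul_le Finset.univ hgt (fun i _ ↦ hp i) fun i _ ↦ hq i)
    rw [Real.logb_mul (Real.rpow_pos_of_pos hC _).ne' (Real.rpow_pos_of_pos hB _).ne',
      Real.logb_rpow_eq_mul_logb_of_pos hC, Real.logb_rpow_eq_mul_logb_of_pos hB] at h
    have hne' : lam - 1 ≠ 0 := sub_ne_zero.2 hlam1
    have h' := div_nonneg (sub_nonneg.2 h) (sub_pos.2 hgt).le
    refine h'.trans_eq ?_
    rw [← neg_sub lam 1]
    field_simp
    ring
end

section
/- Let P, Q, R be probability distributions on {1, …, n} with all entries r_i of R strictly positive, and let λ > 0 with λ ≠ 1. Define the nonuniformity nu(R) = log₂(r_max/r_min), where r_max = max_i r_i and r_min = min_i r_i. Then H_λ(Q) − H_λ(P) − nu(R) ≤ D_λ(P‖R) − D_λ(Q‖R) ≤ H_λ(Q) − H_λ(P) + nu(R). -/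
/-- The Rényi power sum of a nonnegative nonzero vector against positive weights is positive. -/
lemma sum_rpow_mul_rpow_pos {ι : Type*} [Fintype ι] {p r : ι → ℝ} (lam μ : ℝ)
    (hp : ∀ i, 0 ≤ p i) (hpsum : ∑ i, p i = 1) (hr : ∀ i, 0 < r i) :
    0 < ∑ i, p i ^ lam * r i ^ μ := by
  obtain ⟨i, hi, hpi⟩ : ∃ i ∈ Finset.univ, 0 < p i := by
    by_contra! h
    linarith [Finset.sum_nonpos h]
  exact Finset.sum_pos'
    (fun j _ => mul_nonneg (Real.rpow_nonneg (hp j) _) (Real.rpow_nonneg (hr j).le _))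
    ⟨i, hi, mul_pos (Real.rpow_pos_of_pos hpi _) (Real.rpow_pos_of_pos (hr i) _)⟩

/-- The Rényi divergence is antitone in its second argument. -/
lemma renyi_divergence_antitone_right {ι : Type*} [Fintype ι] {p r s : ι → ℝ} {lam : ℝ}
    (hlam1 : lam ≠ 1) (hp : ∀ i, 0 ≤ p i) (hpsum : ∑ i, p i = 1)
    (hr : ∀ i, 0 < r i) (hrs : ∀ i, r i ≤ s i) :
    (1 / (lam - 1)) * Real.logb 2 (∑ i, p i ^ lam * s i ^ (1 - lam))
      ≤ (1 / (lam - 1)) * Real.logb 2 (∑ i, p i ^ lam * r i ^ (1 - lam)) := by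
  have hs i : 0 < s i := (hr i).trans_le (hrs i)
  rcases lt_or_gt_of_ne hlam1 with h | h
  · refine mul_le_mul_of_nonpos_left (Real.logb_le_logb_of_le one_lt_two
      (sum_rpow_mul_rpow_pos _ _ hp hpsum hr) (Finset.sum_le_sum fun i _ => ?_))
      (one_div_nonpos.mpr (by linarith))
    exact mul_le_mul_of_nonneg_left (Real.rpow_le_rpow (hr i).le (hrs i) (by linarith))
      (Real.rpow_nonneg (hp i) _)
  · refine mul_le_mul_of_nonneg_left (Real.logb_le_logb_of_le one_lt_two
      (sum_rpow_mul_rpow_pos _ _ hp hpsum hs) (Finset.sum_le_sum fun i _ => ?_))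
      (one_div_nonneg.mpr (by linarith))
    exact mul_le_mul_of_nonneg_left
      (Real.rpow_le_rpow_of_nonpos (hr i) (hrs i) (by linarith)) (Real.rpow_nonneg (hp i) _)

/-- The Rényi divergence from a constant weight is determined by the Rényi entropy. -/
lemma renyi_divergence_const_right {ι : Type*} [Fintype ι] {p : ι → ℝ} {lam c : ℝ}
    (hlam1 : lam ≠ 1) (hp : ∀ i, 0 ≤ p i) (hpsum : ∑ i, p i = 1) (hc : 0 < c) :
    (1 / (lam - 1)) * Real.logb 2 (∑ i, p i ^ lam * c ^ (1 - lam))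
      = -((1 / (1 - lam)) * Real.logb 2 (∑ i, p i ^ lam)) - Real.logb 2 c := by
  have hS : 0 < ∑ i, p i ^ lam := by
    simpa using sum_rpow_mul_rpow_pos (r := fun _ => 1) lam 1 hp hpsum fun _ => one_pos
  have h1 : lam - 1 ≠ 0 := sub_ne_zero.mpr hlam1
  have h2 : 1 - lam ≠ 0 := sub_ne_zero.mpr hlam1.symm
  rw [← Finset.sum_mul, Real.logb_mul hS.ne' (Real.rpow_pos_of_pos hc _).ne',
    Real.logb_rpow_eq_mul_logb_of_pos hc]
  field_simp
  ring

/-- Sandwich bound relating differences of Rényi divergences to differences of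
Rényi entropies, up to the nonuniformity `nu(R) = log₂(r_max / r_min)`. -/
theorem renyi_divergence_diff_sandwich (n : ℕ) (lam : ℝ)
    (hlam0 : 0 < lam) (hlam1 : lam ≠ 1)
    (p q r : Fin n → ℝ)
    (hp : ∀ i, 0 ≤ p i) (hpsum : ∑ i, p i = 1)
    (hq : ∀ i, 0 ≤ q i) (hqsum : ∑ i, q i = 1)
    (hr : ∀ i, 0 < r i) (hrsum : ∑ i, r i = 1)
    (rmax rmin : ℝ)
    (hmax : IsGreatest (Set.range r) rmax) (hmin : IsLeast (Set.range r) rmin) :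
    (1 / (1 - lam)) * Real.logb 2 (∑ i, q i ^ lam)
      - (1 / (1 - lam)) * Real.logb 2 (∑ i, p i ^ lam)
      - Real.logb 2 (rmax / rmin)
    ≤ (1 / (lam - 1)) * Real.logb 2 (∑ i, p i ^ lam * r i ^ (1 - lam))
      - (1 / (lam - 1)) * Real.logb 2 (∑ i, q i ^ lam * r i ^ (1 - lam))
    ∧ (1 / (lam - 1)) * Real.logb 2 (∑ i, p i ^ lam * r i ^ (1 - lam))
      - (1 / (lam - 1)) * Real.logb 2 (∑ i, q i ^ lam * r i ^ (1 - lam))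
    ≤ (1 / (1 - lam)) * Real.logb 2 (∑ i, q i ^ lam)
      - (1 / (1 - lam)) * Real.logb 2 (∑ i, p i ^ lam)
      + Real.logb 2 (rmax / rmin) := by
  obtain ⟨i, hi⟩ := hmax.1
  obtain ⟨j, hj⟩ := hmin.1
  have hmax0 : 0 < rmax := hi ▸ hr i
  have hmin0 : 0 < rmin := hj ▸ hr j
  have hle k : r k ≤ rmax := hmax.2 ⟨k, rfl⟩
  have hge k : rmin ≤ r k := hmin.2 ⟨k, rfl⟩
  have hp1 := renyi_divergence_antitone_right hlam1 hp hpsum hr hle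
  have hp2 := renyi_divergence_antitone_right hlam1 hp hpsum (fun _ => hmin0) hge
  have hq1 := renyi_divergence_antitone_right hlam1 hq hqsum hr hle
  have hq2 := renyi_divergence_antitone_right hlam1 hq hqsum (fun _ => hmin0) hge
  rw [renyi_divergence_const_right hlam1 hp hpsum hmax0] at hp1
  rw [renyi_divergence_const_right hlam1 hp hpsum hmin0] at hp2
  rw [renyi_divergence_const_right hlam1 hq hqsum hmax0] at hq1
  rw [renyi_divergence_const_right hlam1 hq hqsum hmin0] at hq2
  rw [Real.logb_div hmax0.ne' hmin0.ne']
  constructor <;> linarith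
end

section
/- Let N be a finite set and f : 2^N → ℝ monotone and supermodular. Let i_1, …, i_l be distinct elements of N; set A_0 = N, A_r = A_{r−1} \ {i_r}, and Δ_r = f(A_{r−1}) − f(A_r) for 1 ≤ r ≤ l. For j ∈ N and 1 ≤ k ≤ l define a_k^j = [f(A_{k−1}) − f(A_k)] − [f(A_{k−1} \ {j}) − f(A_k \ {j})]. Assume the greedy-choice property: for every 1 ≤ r ≤ l and every j ∈ A_{r−1}, Δ_r ≥ f(A_{r−1}) − f(A_{r−1} \ {j}). Then for every j ∈ N and every real X_j with X_j ≤ f(N) − f(N \ {j}), and every 1 ≤ r ≤ l, Δ_r ≥ X_j − Σ_{k=1}^{r−1} a_k^j. -/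
theorem sum_Icc_one_pred_sub {G : Type*} [AddCommGroup G] (g : ℕ → G) (n : ℕ) :
    ∑ k ∈ Finset.Icc 1 n, (g (k - 1) - g k) = g 0 - g n := by
  induction n with
  | zero => simp
  | succ n ih =>
    rw [Finset.sum_Icc_succ_top (by omega), ih, Nat.add_sub_cancel]
    abel

/-- Key inequality in the analysis of ReverseGreedy: with the greedy-choice
property, for any `X_j ≤ f(N) − f(N∖{j})` we have
`Δ_r ≥ X_j − Σ_{k=1}^{r−1} a_k^j`. -/
theorem greedy_delta_lower_bound {N : Type*} [Fintype N] [DecidableEq N]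
    (f : Finset N → ℝ)
    (hmono : ∀ S T : Finset N, S ⊆ T → f S ≤ f T)
    (hsuper : ∀ S T : Finset N, f S + f T ≤ f (S ∪ T) + f (S ∩ T))
    (l : ℕ) (idx : ℕ → N)
    (hdistinct : ∀ r s : ℕ, 1 ≤ r → r ≤ l → 1 ≤ s → s ≤ l → idx r = idx s → r = s)
    (A : ℕ → Finset N) (hA0 : A 0 = Finset.univ)
    (hAmem : ∀ r : ℕ, 1 ≤ r → r ≤ l → idx r ∈ A (r - 1))
    (hAstep : ∀ r : ℕ, 1 ≤ r → r ≤ l → A r = (A (r - 1)).erase (idx r))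
    (Δ : ℕ → ℝ) (hΔ : ∀ r : ℕ, 1 ≤ r → r ≤ l → Δ r = f (A (r - 1)) - f (A r))
    (a : ℕ → N → ℝ)
    (ha : ∀ (k : ℕ) (j : N), 1 ≤ k → k ≤ l →
      a k j = (f (A (k - 1)) - f (A k)) -
        (f ((A (k - 1)).erase j) - f ((A k).erase j)))
    (hgreedy : ∀ r : ℕ, 1 ≤ r → r ≤ l →
      ∀ j ∈ A (r - 1), f (A (r - 1)) - f ((A (r - 1)).erase j) ≤ Δ r)
    (j : N) (X : ℝ) (hX : X ≤ f Finset.univ - f (Finset.univ.erase j))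
    (r : ℕ) (hr1 : 1 ≤ r) (hrl : r ≤ l) :
    X - ∑ k ∈ Finset.Icc 1 (r - 1), a k j ≤ Δ r := by
  have hsum : ∑ k ∈ Finset.Icc 1 (r - 1), a k j =
      (f (A 0) - f ((A 0).erase j)) - (f (A (r - 1)) - f ((A (r - 1)).erase j)) := by
    rw [← sum_Icc_one_pred_sub (fun k => f (A k) - f ((A k).erase j))]
    refine Finset.sum_congr rfl fun k hk => ?_
    rw [Finset.mem_Icc] at hk
    rw [ha k j hk.1 (by omega)]
    ring
  have hmarginal : f (A (r - 1)) - f ((A (r - 1)).erase j) ≤ Δ r := by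
    by_cases hj : j ∈ A (r - 1)
    · exact hgreedy r hr1 hrl j hj
    · rw [Finset.erase_eq_of_notMem hj, sub_self, hΔ r hr1 hrl, hAstep r hr1 hrl]
      exact sub_nonneg.mpr (hmono _ _ (Finset.erase_subset _ _))
  rw [hsum, hA0]
  linarith
end

section
/- Let λ > 1 and α > 0 be reals, and l, m positive integers. Let Δ_1, …, Δ_l be nonnegative reals, X_1, …, X_m nonnegative integers, and Z_r^j (1 ≤ r ≤ l, 1 ≤ j ≤ m) nonnegative integers satisfying: (i) X_j = Σ_{r=1}^l Z_r^j for every j; (ii) Δ_r ≥ X_j − Σ_{k=1}^{r−1} Z_k^j for every r and j; (iii) Σ_{j=1}^m Z_r^j ≤ α·Δ_r for every r. Then α·Σ_{r=1}^l Δ_r^λ ≥ (1/λ)·Σ_{j=1}^m X_j^λ. -/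
/-- The tangent line of `x ↦ x ^ p` at `a` lies below the graph. -/
theorem rpow_le_rpow_add_mul_sub {p a b : ℝ} (hp : 1 ≤ p) (ha : 0 ≤ a) (hb : 0 ≤ b) :
    a ^ p ≤ b ^ p + p * a ^ (p - 1) * (a - b) := by
  rcases ha.eq_or_lt with rfl | ha
  · rcases hp.eq_or_lt with rfl | hp
    · simp
    · rw [Real.zero_rpow (by linarith), Real.zero_rpow (by linarith)]
      have := Real.rpow_nonneg hb p
      linarith
  · have bernoulli : 1 + p * (b / a - 1) ≤ (1 + (b / a - 1)) ^ p :=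
      one_add_mul_self_le_rpow_one_add (by have := div_nonneg hb ha.le; linarith) hp
    rw [add_sub_cancel, Real.div_rpow hb ha.le, le_div_iff₀ (Real.rpow_pos_of_pos ha p)]
      at bernoulli
    have hpow : a ^ p = a ^ (p - 1) * a := by
      rw [← Real.rpow_add_one ha.ne', sub_add_cancel]
    have : (1 + p * (b / a - 1)) * a ^ p = a ^ p - p * a ^ (p - 1) * (a - b) := by
      rw [hpow]
      field_simp
      ring
    linarith

/-- Abel-type bound: if `d` dominates the tail sums of `z`, then `(∑ z) ^ p ≤ p ∑ d ^ (p - 1) z`. -/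
theorem sum_rpow_le_mul_sum_of_tail_le {p : ℝ} (hp : 1 ≤ p) {n : ℕ} (z d : Fin n → ℝ)
    (hz : ∀ r, 0 ≤ z r)
    (hd : ∀ r, ∑ k, z k - ∑ k ∈ Finset.univ.filter (fun k => k < r), z k ≤ d r) :
    (∑ r, z r) ^ p ≤ p * ∑ r, d r ^ (p - 1) * z r := by
  induction n with
  | zero => simp [Real.zero_rpow (by linarith : p ≠ 0)]
  | succ n ih =>
    have htail : (∑ r : Fin n, z r.succ) ^ p ≤ p * ∑ r : Fin n, d r.succ ^ (p - 1) * z r.succ := by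
      refine ih (fun r => z r.succ) (fun r => d r.succ) (fun r => hz _) fun r => ?_
      have := hd r.succ
      simp only [Finset.sum_filter, Fin.sum_univ_succ, Fin.succ_pos, if_true,
        Fin.succ_lt_succ_iff] at this ⊢
      linarith
    have hsum : 0 ≤ ∑ r, z r := Finset.sum_nonneg fun r _ => hz r
    have htangent := rpow_le_rpow_add_mul_sub hp hsum
      (Finset.sum_nonneg (s := Finset.univ) fun (r : Fin n) _ => hz r.succ)
    have hhead : ∑ r, z r ≤ d 0 := by simpa using hd 0
    have hmono : p * (∑ r, z r) ^ (p - 1) * z 0 ≤ p * d 0 ^ (p - 1) * z 0 := by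
      have := Real.rpow_le_rpow hsum hhead (sub_nonneg.2 hp)
      have := hz 0
      gcongr
    have hdiff : ∑ r, z r - ∑ r : Fin n, z r.succ = z 0 := by
      rw [Fin.sum_univ_succ, add_sub_cancel_right]
    rw [hdiff] at htangent
    rw [Fin.sum_univ_succ (fun r => d r ^ (p - 1) * z r), mul_add, ← mul_assoc]
    linarith

/-- Power-sum inequality behind the ReverseGreedy guarantee, case `λ > 1`:
`α · Σ_r Δ_r^λ ≥ (1/λ) · Σ_j X_j^λ`. -/
theorem powersum_reverse_greedy_gt_one (lam α : ℝ) (hlam : 1 < lam) (hα : 0 < α)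
    (l m : ℕ) (hl : 0 < l) (hm : 0 < m)
    (Δ : Fin l → ℝ) (hΔ : ∀ r, 0 ≤ Δ r)
    (X : Fin m → ℕ) (Z : Fin l → Fin m → ℕ)
    (hXZ : ∀ j, X j = ∑ r, Z r j)
    (hΔX : ∀ (r : Fin l) (j : Fin m),
      (X j : ℝ) - ∑ k ∈ Finset.univ.filter (fun k => k < r), (Z k j : ℝ) ≤ Δ r)
    (hZα : ∀ r, ∑ j, (Z r j : ℝ) ≤ α * Δ r) :
    (1 / lam) * ∑ j, (X j : ℝ) ^ lam ≤ α * ∑ r, Δ r ^ lam := by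
  have hX : ∀ j, (X j : ℝ) ^ lam ≤ lam * ∑ r, Δ r ^ (lam - 1) * (Z r j : ℝ) := by
    intro j
    have hcast : (X j : ℝ) = ∑ r, (Z r j : ℝ) := by rw [hXZ j, Nat.cast_sum]
    rw [hcast]
    exact sum_rpow_le_mul_sum_of_tail_le hlam.le _ Δ (fun r => Nat.cast_nonneg _)
      fun r => hcast ▸ hΔX r j
  rw [one_div, inv_mul_le_iff₀ (by linarith)]
  calc ∑ j, (X j : ℝ) ^ lam
      ≤ ∑ j, lam * ∑ r, Δ r ^ (lam - 1) * (Z r j : ℝ) := Finset.sum_le_sum fun j _ => hX j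
    _ = lam * ∑ r, Δ r ^ (lam - 1) * ∑ j, (Z r j : ℝ) := by
      rw [← Finset.mul_sum, Finset.sum_comm]
      simp only [Finset.mul_sum]
    _ ≤ lam * ∑ r, Δ r ^ (lam - 1) * (α * Δ r) := by
      gcongr with r
      · exact Real.rpow_nonneg (hΔ r) _
      · exact hZα r
    _ = lam * (α * ∑ r, Δ r ^ lam) := by
      rw [Finset.mul_sum _ _ α]
      congr 1
      refine Finset.sum_congr rfl fun r _ => ?_
      have hpow : Δ r ^ lam = Δ r ^ (lam - 1) * Δ r := by
        rw [← Real.rpow_add_one' (hΔ r) (by linarith), sub_add_cancel]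
      rw [hpow]
      ring
end

section
/- Let λ and β be reals with 0 < λ < 1 and β > 0, and l, m positive integers. Let Δ_1, …, Δ_l be nonnegative reals, X_1, …, X_m nonnegative integers, and Z_r^j (1 ≤ r ≤ l, 1 ≤ j ≤ m) nonnegative integers satisfying: (i) X_j = Σ_{r=1}^l Z_r^j for every j; (ii) Δ_r ≥ X_j − Σ_{k=1}^{r−1} Z_k^j for every r and j; (iii) β·Δ_r ≤ Σ_{j=1}^m Z_r^j for every r. Then β·Σ_{r=1}^l Δ_r^λ ≤ (1/λ)·Σ_{j=1}^m X_j^λ. -/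
theorem mul_rpow_sub_one_le_rpow_sub_rpow {p z x d : ℝ} (hp0 : 0 < p) (hp1 : p < 1)
    (hz : 0 ≤ z) (hzx : z ≤ x) (hxd : x ≤ d) :
    p * (z * d ^ (p - 1)) ≤ x ^ p - (x - z) ^ p := by
  rcases (hz.trans hzx).eq_or_lt with hx | hx
  · have hz0 : z = 0 := by linarith
    simp [hz0]
  have hd : d ^ (p - 1) ≤ x ^ (p - 1) :=
    Real.rpow_le_rpow_of_nonpos hx hxd (by linarith)
  have hbern : (1 + -(z / x)) ^ p ≤ 1 + p * -(z / x) :=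
    rpow_one_add_le_one_add_mul_self (neg_le_neg ((div_le_one hx).2 hzx)) hp0.le hp1.le
  have hbase : 0 ≤ 1 + -(z / x) := by linarith [(div_le_one hx).2 hzx]
  have hfactor : (x - z) ^ p = x ^ p * (1 + -(z / x)) ^ p := by
    rw [← Real.mul_rpow hx.le hbase]
    congr 1
    field_simp
    ring
  calc
    p * (z * d ^ (p - 1)) ≤ p * (z * x ^ (p - 1)) := by gcongr
    _ = x ^ p - x ^ p * (1 + p * -(z / x)) := by
      rw [Real.rpow_sub_one hx.ne']
      ring
    _ ≤ x ^ p - (x - z) ^ p := by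
      rw [hfactor]
      gcongr

theorem Fin.sum_filter_val_lt_succ {l : ℕ} (z : Fin l → ℝ) (r : Fin l) :
    ∑ k ∈ Finset.univ.filter (fun k : Fin l => k.val < r.val + 1), z k =
      ∑ k ∈ Finset.univ.filter (fun k => k < r), z k + z r := by
  have h : Finset.univ.filter (fun k : Fin l => k.val < r.val + 1) =
      insert r (Finset.univ.filter (fun k => k < r)) := by
    ext k
    simp only [Finset.mem_filter, Finset.mem_univ, true_and, Finset.mem_insert]
    omega
  rw [h, Finset.sum_insert (by simp), add_comm]

theorem sum_mul_rpow_sub_one_le_rpow_sum {p : ℝ} (hp0 : 0 < p) (hp1 : p < 1) {l : ℕ}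
    (d z : Fin l → ℝ) (hz : ∀ r, 0 ≤ z r)
    (hd : ∀ r, ∑ k, z k - ∑ k ∈ Finset.univ.filter (fun k => k < r), z k ≤ d r) :
    p * ∑ r, z r * d r ^ (p - 1) ≤ (∑ r, z r) ^ p := by
  let R : ℕ → ℝ := fun n =>
    ∑ k, z k - ∑ k ∈ Finset.univ.filter (fun k : Fin l => k.val < n), z k
  have hR (n : ℕ) : 0 ≤ R n :=
    sub_nonneg.2 (Finset.sum_le_sum_of_subset_of_nonneg (Finset.filter_subset _ _)
      fun k _ _ => hz k)
  have hsucc (r : Fin l) : R (r.val + 1) = R r.val - z r := by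
    simp only [R, Fin.sum_filter_val_lt_succ z r, Fin.lt_def]
    ring
  have hR0 : R 0 = ∑ k, z k := by simp [R]
  calc
    p * ∑ r, z r * d r ^ (p - 1) = ∑ r, p * (z r * d r ^ (p - 1)) := Finset.mul_sum ..
    _ ≤ ∑ r : Fin l, (R r.val ^ p - R (r.val + 1) ^ p) := by
      refine Finset.sum_le_sum fun r _ => ?_
      rw [hsucc r]
      refine mul_rpow_sub_one_le_rpow_sub_rpow hp0 hp1 (hz r) ?_ (hd r)
      linarith [hsucc r, hR (r.val + 1)]
    _ = R 0 ^ p - R l ^ p := by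
      rw [Fin.sum_univ_eq_sum_range (fun n => R n ^ p - R (n + 1) ^ p),
        Finset.sum_range_sub' (fun n => R n ^ p)]
    _ ≤ (∑ r, z r) ^ p := by
      rw [hR0]
      linarith [Real.rpow_nonneg (hR l) p]


/-- Power-sum inequality behind the ReverseGreedy guarantee, case `0 < λ < 1`:
`β · Σ_r Δ_r^λ ≤ (1/λ) · Σ_j X_j^λ`. -/
theorem powersum_reverse_greedy_lt_one (lam β : ℝ)
    (hlam0 : 0 < lam) (hlam1 : lam < 1) (hβ : 0 < β)
    (l m : ℕ) (hl : 0 < l) (hm : 0 < m)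
    (Δ : Fin l → ℝ) (hΔ : ∀ r, 0 ≤ Δ r)
    (X : Fin m → ℕ) (Z : Fin l → Fin m → ℕ)
    (hXZ : ∀ j, X j = ∑ r, Z r j)
    (hΔX : ∀ (r : Fin l) (j : Fin m),
      (X j : ℝ) - ∑ k ∈ Finset.univ.filter (fun k => k < r), (Z k j : ℝ) ≤ Δ r)
    (hZβ : ∀ r, β * Δ r ≤ ∑ j, (Z r j : ℝ)) :
    β * ∑ r, Δ r ^ lam ≤ (1 / lam) * ∑ j, (X j : ℝ) ^ lam := by
  have hterm (r : Fin l) : β * Δ r ^ lam ≤ ∑ j, (Z r j : ℝ) * Δ r ^ (lam - 1) := by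
    rcases (hΔ r).eq_or_lt with h | h
    · rw [← h, Real.zero_rpow hlam0.ne', mul_zero]
      positivity
    · calc
        β * Δ r ^ lam = β * Δ r * Δ r ^ (lam - 1) := by
          rw [Real.rpow_sub_one h.ne']
          field_simp
        _ ≤ (∑ j, (Z r j : ℝ)) * Δ r ^ (lam - 1) :=
          mul_le_mul_of_nonneg_right (hZβ r) (Real.rpow_nonneg h.le _)
        _ = ∑ j, (Z r j : ℝ) * Δ r ^ (lam - 1) := Finset.sum_mul ..
  have hX (j : Fin m) : (X j : ℝ) = ∑ r, (Z r j : ℝ) := by exact_mod_cast hXZ j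
  have hcol (j : Fin m) :
      ∑ r, (Z r j : ℝ) * Δ r ^ (lam - 1) ≤ (1 / lam) * (X j : ℝ) ^ lam := by
    rw [one_div, ← div_eq_inv_mul, le_div_iff₀' hlam0, hX j]
    exact sum_mul_rpow_sub_one_le_rpow_sum hlam0 hlam1 Δ _ (fun r => Nat.cast_nonneg _)
      fun r => hX j ▸ hΔX r j
  calc
    β * ∑ r, Δ r ^ lam = ∑ r, β * Δ r ^ lam := Finset.mul_sum ..
    _ ≤ ∑ r, ∑ j, (Z r j : ℝ) * Δ r ^ (lam - 1) := Finset.sum_le_sum fun r _ => hterm r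
    _ = ∑ j, ∑ r, (Z r j : ℝ) * Δ r ^ (lam - 1) := Finset.sum_comm
    _ ≤ ∑ j, (1 / lam) * (X j : ℝ) ^ lam := Finset.sum_le_sum fun j _ => hcol j
    _ = (1 / lam) * ∑ j, (X j : ℝ) ^ lam := (Finset.mul_sum ..).symm
end

section
/- Let λ > 1 and α > 0 be reals, and l, m positive integers. Let Δ_1, …, Δ_l be nonnegative reals and X_1, …, X_m nonnegative integers with Σ_{r=1}^l Δ_r = Σ_{j=1}^m X_j = T > 0, and suppose there exist nonnegative integers Z_r^j (1 ≤ r ≤ l, 1 ≤ j ≤ m) such that: (i) X_j = Σ_{r=1}^l Z_r^j for every j; (ii) Δ_r ≥ X_j − Σ_{k=1}^{r−1} Z_k^j for every r and j; (iii) Σ_{j=1}^m Z_r^j ≤ α·Δ_r for every r. Then H_λ(Δ/T) ≤ H_λ(X/T) + (1/(λ−1))·log₂(α·λ). -/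
/-- The tangent line at `x` lies below `t ↦ t ^ p` on the nonnegative reals. -/
theorem rpow_le_rpow_add_tangent {p x y : ℝ} (hp : 1 < p) (hx : 0 ≤ x) (hy : 0 ≤ y) :
    x ^ p ≤ y ^ p + p * x ^ (p - 1) * (x - y) := by
  rcases hx.eq_or_lt with rfl | hx
  · rw [Real.zero_rpow (by linarith), Real.zero_rpow (by linarith)]
    simpa using Real.rpow_nonneg hy p
  · have hyx : 0 ≤ y / x := div_nonneg hy hx.le
    have h := one_add_mul_self_le_rpow_one_add (s := y / x - 1) (by linarith) hp.le
    rw [add_sub_cancel, Real.div_rpow hy hx.le, le_div_iff₀ (Real.rpow_pos_of_pos hx p)] at h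
    have hpow : x ^ p = x ^ (p - 1) * x := by
      rw [← Real.rpow_add_one hx.ne', sub_add_cancel]
    have hlin : (1 + p * (y / x - 1)) * x ^ p = x ^ p - p * x ^ (p - 1) * (x - y) := by
      rw [hpow]
      field_simp
      ring
    linarith

/-- If `d r` dominates the tail sum of `f` from `r` on, then the `p`-th power of the total is at
most `p * ∑ r, d r ^ (p - 1) * f r`. -/
theorem sum_rpow_le_of_tail_le {p : ℝ} (hp : 1 < p) {n : ℕ} (f d : Fin n → ℝ)
    (hf : ∀ r, 0 ≤ f r)
    (hd : ∀ r, ∑ k, f k - ∑ k ∈ Finset.univ.filter (fun k => k < r), f k ≤ d r) :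
    (∑ k, f k) ^ p ≤ p * ∑ r, d r ^ (p - 1) * f r := by
  induction n with
  | zero => simp [Real.zero_rpow (show p ≠ 0 by linarith)]
  | succ n ih =>
    have htail := ih (fun k => f k.succ) (fun k => d k.succ) (fun k => hf _) fun r => by
      have h := hd r.succ
      simp only [Finset.sum_filter, Fin.sum_univ_succ, Fin.succ_pos, if_true,
        Fin.succ_lt_succ_iff] at h ⊢
      linarith
    have h0 : ∑ k, f k ≤ d 0 := by simpa using hd 0
    have hsum : 0 ≤ ∑ k, f k := Finset.sum_nonneg fun k _ => hf k
    have htangent := rpow_le_rpow_add_tangent hp hsum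
      (Finset.sum_nonneg fun k _ => hf k.succ : 0 ≤ ∑ k : Fin n, f k.succ)
    have hdiff : ∑ k, f k - ∑ k : Fin n, f k.succ = f 0 := by
      rw [Fin.sum_univ_succ]
      ring
    have hmono : p * ((∑ k, f k) ^ (p - 1) * f 0) ≤ p * (d 0 ^ (p - 1) * f 0) := by
      have := hf 0
      gcongr
    rw [hdiff] at htangent
    rw [Fin.sum_univ_succ (fun r => d r ^ (p - 1) * f r), mul_add]
    linarith


/-- Rényi-entropy version of the ReverseGreedy guarantee, case `λ > 1`:
`H_λ(Δ/T) ≤ H_λ(X/T) + (1/(λ−1))·log₂(αλ)`. -/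
theorem renyi_reverse_greedy_gt_one (lam α : ℝ) (hlam : 1 < lam) (hα : 0 < α)
    (l m : ℕ) (hl : 0 < l) (hm : 0 < m)
    (Δ : Fin l → ℝ) (hΔ : ∀ r, 0 ≤ Δ r)
    (X : Fin m → ℕ) (T : ℝ) (hT : 0 < T)
    (hΔT : ∑ r, Δ r = T) (hXT : ∑ j, (X j : ℝ) = T)
    (Z : Fin l → Fin m → ℕ)
    (hXZ : ∀ j, X j = ∑ r, Z r j)
    (hΔX : ∀ (r : Fin l) (j : Fin m),
      (X j : ℝ) - ∑ k ∈ Finset.univ.filter (fun k => k < r), (Z k j : ℝ) ≤ Δ r)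
    (hZα : ∀ r, ∑ j, (Z r j : ℝ) ≤ α * Δ r) :
    (1 / (1 - lam)) * Real.logb 2 (∑ r, (Δ r / T) ^ lam) ≤
      (1 / (1 - lam)) * Real.logb 2 (∑ j, ((X j : ℝ) / T) ^ lam)
        + (1 / (lam - 1)) * Real.logb 2 (α * lam) := by
  have hpow : ∑ j, (X j : ℝ) ^ lam ≤ α * lam * ∑ r, Δ r ^ lam := by
    calc ∑ j, (X j : ℝ) ^ lam
        ≤ ∑ j, lam * ∑ r, Δ r ^ (lam - 1) * (Z r j : ℝ) := by
          refine Finset.sum_le_sum fun j _ => ?_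
          have hX : (X j : ℝ) = ∑ r, (Z r j : ℝ) := by rw [hXZ j, Nat.cast_sum]
          have hd := fun r => hΔX r j
          rw [hX] at hd ⊢
          exact sum_rpow_le_of_tail_le hlam _ Δ (fun r => Nat.cast_nonneg _) hd
      _ = lam * ∑ r, Δ r ^ (lam - 1) * ∑ j, (Z r j : ℝ) := by
          rw [← Finset.mul_sum, Finset.sum_comm]
          simp_rw [Finset.mul_sum]
      _ ≤ lam * ∑ r, Δ r ^ (lam - 1) * (α * Δ r) := by
          gcongr with r
          · exact Real.rpow_nonneg (hΔ r) _
          · exact hZα r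
      _ = α * lam * ∑ r, Δ r ^ lam := by
          rw [Finset.mul_sum, Finset.mul_sum]
          refine Finset.sum_congr rfl fun r _ => ?_
          have h : Δ r ^ lam = Δ r ^ (lam - 1) * Δ r := by
            rw [← Real.rpow_add_one' (hΔ r) (by linarith), sub_add_cancel]
          rw [h]
          ring
  have hTpow : 0 < T ^ lam := Real.rpow_pos_of_pos hT lam
  have hXpos : 0 < ∑ j, (X j : ℝ) ^ lam := by
    obtain ⟨j, -, hj⟩ : ∃ j ∈ Finset.univ, (0 : ℝ) < X j :=
      Finset.exists_lt_of_sum_lt (f := fun _ : Fin m => (0 : ℝ)) (by simpa [hXT] using hT)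
    exact Finset.sum_pos' (fun _ _ => by positivity)
      ⟨j, Finset.mem_univ j, Real.rpow_pos_of_pos hj lam⟩
  have hαlam : 0 < α * lam := by positivity
  have hΔpos : 0 < ∑ r, Δ r ^ lam := pos_of_mul_pos_right (hXpos.trans_le hpow) hαlam.le
  simp_rw [Real.div_rpow (hΔ _) hT.le, Real.div_rpow (Nat.cast_nonneg _) hT.le,
    ← Finset.sum_div]
  have hlog : Real.logb 2 ((∑ j, (X j : ℝ) ^ lam) / T ^ lam) ≤
      Real.logb 2 (α * lam) + Real.logb 2 ((∑ r, Δ r ^ lam) / T ^ lam) := by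
    rw [← Real.logb_mul hαlam.ne' (div_pos hΔpos hTpow).ne', ← mul_div_assoc]
    exact Real.logb_le_logb_of_le one_lt_two (by positivity) (by gcongr)
  have hneg : 1 / (1 - lam) = -(1 / (lam - 1)) := by
    rw [← neg_sub lam 1, div_neg]
  have hscaled := mul_le_mul_of_nonneg_left hlog (one_div_pos.mpr (sub_pos.mpr hlam)).le
  rw [hneg]
  linarith
end

section
/- Let λ and β be reals with 0 < λ < 1 and β > 0, and l, m positive integers. Let Δ_1, …, Δ_lature be nonnegative reals and X_1, …, X_m nonnegative integers with Σ_{r=1}^l Δ_r = Σ_{j=1}^m X_j = T > 0, and suppose there exist nonnegative integers Z_r^j (1 ≤ r ≤ l, 1 ≤ j ≤ m) such that: (i) X_j = Σ_{r=1}^l Z_r^j for every j; (ii) Δ_r ≥ X_j − Σ_{k=1}^{r−1} Z_k^j for every r and j; (iii) β·Δ_r ≤ Σ_{j=1}^m Z_r^j for every r. Then H_λ(Δ/T) ≤ H_λ(X/T) + (1/(λ−1))·log₂(β·λ). -/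
/-- A sum over a linearly ordered finset of increments between consecutive partial sums
telescopes. -/
theorem Finset.sum_sub_partialSum_telescope {ι : Type*} [LinearOrder ι] (s : Finset ι)
    (a : ι → ℝ) (g : ℝ → ℝ) :
    ∑ r ∈ s, (g (∑ k ∈ s.filter (fun k => k < r), a k)
      - g (∑ k ∈ s.filter (fun k => k < r), a k + a r)) = g 0 - g (∑ r ∈ s, a r) := by
  induction s using Finset.induction_on_max with
  | empty => simp
  | insert b s hb ih =>
    have hbs : b ∉ s := fun h => lt_irrefl _ (hb b h)
    have hfilter_max : (insert b s).filter (fun k => k < b) = s := by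
      rw [Finset.filter_insert, if_neg (lt_irrefl b), Finset.filter_true_of_mem hb]
    have hsum : ∑ r ∈ s, (g (∑ k ∈ (insert b s).filter (fun k => k < r), a k)
        - g (∑ k ∈ (insert b s).filter (fun k => k < r), a k + a r)) =
        g 0 - g (∑ r ∈ s, a r) := by
      rw [← ih]
      refine Finset.sum_congr rfl fun r hr => ?_
      rw [Finset.filter_insert, if_neg (hb r hr).not_gt]
    rw [Finset.sum_insert hbs, hfilter_max, Finset.sum_insert hbs, hsum, add_comm (a b)]
    ring

/-- The tangent-line bound for the concave function `x ↦ x ^ p`, with the slope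
evaluated at a point `d ≥ x`. -/
theorem Real.mul_mul_rpow_sub_one_le_rpow_sub_rpow {p x z d : ℝ} (hp0 : 0 < p) (hp1 : p < 1)
    (hz : 0 ≤ z) (hzx : z ≤ x) (hxd : x ≤ d) :
    p * (z * d ^ (p - 1)) ≤ x ^ p - (x - z) ^ p := by
  rcases (hz.trans hzx).eq_or_lt with rfl | hx
  · obtain rfl : z = 0 := le_antisymm hzx hz
    simp
  have hslope : d ^ (p - 1) ≤ x ^ (p - 1) :=
    Real.rpow_le_rpow_of_nonpos hx hxd (by linarith)
  have hzx1 : z / x ≤ 1 := (div_le_one hx).2 hzx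
  have hbern : (1 + -(z / x)) ^ p ≤ 1 + p * -(z / x) :=
    rpow_one_add_le_one_add_mul_self (by linarith) hp0.le hp1.le
  have hfactor : (x - z) ^ p = x ^ p * (1 + -(z / x)) ^ p := by
    rw [← Real.mul_rpow hx.le (by linarith)]
    congr 1
    field_simp
    ring
  calc p * (z * d ^ (p - 1)) ≤ p * (z * x ^ (p - 1)) := by gcongr
    _ = x ^ p - x ^ p * (1 + p * -(z / x)) := by
      rw [Real.rpow_sub_one hx.ne']
      ring
    _ ≤ x ^ p - (x - z) ^ p := by
      rw [hfactor]
      gcongr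

/-- The power-sum inequality behind the Rényi entropy bound for `0 < p < 1`. -/
theorem Real.mul_sum_rpow_le_sum_rpow_of_peeling {ι κ : Type*} [Fintype ι] [LinearOrder ι]
    [Fintype κ] {p β : ℝ} (hp0 : 0 < p) (hp1 : p < 1) {Δ : ι → ℝ} (hΔ : ∀ r, 0 ≤ Δ r)
    {X : κ → ℝ} {Z : ι → κ → ℝ} (hZ : ∀ r j, 0 ≤ Z r j) (hXZ : ∀ j, X j = ∑ r, Z r j)
    (hΔX : ∀ r j, X j - ∑ k ∈ Finset.univ.filter (fun k => k < r), Z k j ≤ Δ r)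
    (hZβ : ∀ r, β * Δ r ≤ ∑ j, Z r j) :
    β * p * ∑ r, Δ r ^ p ≤ ∑ j, X j ^ p := by
  have hrow : ∀ r, β * p * Δ r ^ p ≤ ∑ j, p * (Z r j * Δ r ^ (p - 1)) := fun r => by
    have hpow : Δ r ^ p = Δ r * Δ r ^ (p - 1) := by
      rcases (hΔ r).eq_or_lt with h | h
      · rw [← h, Real.zero_rpow hp0.ne', zero_mul]
      · rw [Real.rpow_sub_one h.ne', mul_div_cancel₀ _ h.ne']
    rw [← Finset.mul_sum, ← Finset.sum_mul, hpow]
    calc β * p * (Δ r * Δ r ^ (p - 1)) = p * (β * Δ r * Δ r ^ (p - 1)) := by ring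
      _ ≤ _ := by
        have := Real.rpow_nonneg (hΔ r) (p - 1)
        have := hZβ r
        gcongr
  have hcol : ∀ j, ∑ r, p * (Z r j * Δ r ^ (p - 1)) ≤ X j ^ p := fun j => by
    have htel := Finset.sum_sub_partialSum_telescope Finset.univ (fun r => Z r j)
      (fun t => (X j - t) ^ p)
    simp only [← hXZ j, sub_zero, sub_self, Real.zero_rpow hp0.ne'] at htel
    rw [← htel]
    refine Finset.sum_le_sum fun r _ => ?_
    rw [← sub_sub]
    refine Real.mul_mul_rpow_sub_one_le_rpow_sub_rpow hp0 hp1 (hZ r j) ?_ (hΔX r j)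
    have hr : r ∉ Finset.univ.filter (fun k => k < r) := by simp
    have hle : ∑ k ∈ insert r (Finset.univ.filter (fun k => k < r)), Z k j ≤ X j := by
      rw [hXZ j]
      exact Finset.sum_le_sum_of_subset_of_nonneg (Finset.subset_univ _) fun k _ _ => hZ k j
    rw [Finset.sum_insert hr] at hle
    linarith
  calc β * p * ∑ r, Δ r ^ p = ∑ r, β * p * Δ r ^ p := Finset.mul_sum ..
    _ ≤ ∑ r, ∑ j, p * (Z r j * Δ r ^ (p - 1)) := Finset.sum_le_sum fun r _ => hrow r
    _ = ∑ j, ∑ r, p * (Z r j * Δ r ^ (p - 1)) := Finset.sum_comm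
    _ ≤ ∑ j, X j ^ p := Finset.sum_le_sum fun j _ => hcol j


/-- Rényi-entropy version of the ReverseGreedy guarantee, case `0 < λ < 1`:
`H_λ(Δ/T) ≤ H_λ(X/T) + (1/(λ−1))·log₂(βλ)`. -/
theorem renyi_reverse_greedy_lt_one (lam β : ℝ)
    (hlam0 : 0 < lam) (hlam1 : lam < 1) (hβ : 0 < β)
    (l m : ℕ) (hl : 0 < l) (hm : 0 < m)
    (Δ : Fin l → ℝ) (hΔ : ∀ r, 0 ≤ Δ r)
    (X : Fin m → ℕ) (T : ℝ) (hT : 0 < T)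
    (hΔT : ∑ r, Δ r = T) (hXT : ∑ j, (X j : ℝ) = T)
    (Z : Fin l → Fin m → ℕ)
    (hXZ : ∀ j, X j = ∑ r, Z r j)
    (hΔX : ∀ (r : Fin l) (j : Fin m),
      (X j : ℝ) - ∑ k ∈ Finset.univ.filter (fun k => k < r), (Z k j : ℝ) ≤ Δ r)
    (hZβ : ∀ r, β * Δ r ≤ ∑ j, (Z r j : ℝ)) :
    (1 / (1 - lam)) * Real.logb 2 (∑ r, (Δ r / T) ^ lam) ≤
      (1 / (1 - lam)) * Real.logb 2 (∑ j, ((X j : ℝ) / T) ^ lam)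
        + (1 / (lam - 1)) * Real.logb 2 (β * lam) := by
  have hpower : β * lam * ∑ r, Δ r ^ lam ≤ ∑ j, (X j : ℝ) ^ lam :=
    Real.mul_sum_rpow_le_sum_rpow_of_peeling hlam0 hlam1 hΔ (Z := fun r j => (Z r j : ℝ))
      (fun r j => Nat.cast_nonneg _) (fun j => by rw [hXZ j]; push_cast; rfl) hΔX hZβ
  have hsum_div : ∑ r, (Δ r / T) ^ lam = (∑ r, Δ r ^ lam) / T ^ lam := by
    rw [Finset.sum_div]
    exact Finset.sum_congr rfl fun r _ => Real.div_rpow (hΔ r) hT.le lam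
  have hsum_div' : ∑ j, ((X j : ℝ) / T) ^ lam = (∑ j, (X j : ℝ) ^ lam) / T ^ lam := by
    rw [Finset.sum_div]
    exact Finset.sum_congr rfl fun j _ => Real.div_rpow (Nat.cast_nonneg _) hT.le lam
  have hnormalized : β * lam * ∑ r, (Δ r / T) ^ lam ≤ ∑ j, ((X j : ℝ) / T) ^ lam := by
    rw [hsum_div, hsum_div', ← mul_div_assoc]
    gcongr
  have hpos : 0 < ∑ r, (Δ r / T) ^ lam := by
    obtain ⟨r, -, hr⟩ : ∃ r ∈ Finset.univ, 0 < Δ r :=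
      Finset.exists_lt_of_sum_lt (by simpa [hΔT] using hT)
    exact Finset.sum_pos' (fun k _ => Real.rpow_nonneg (div_nonneg (hΔ k) hT.le) lam)
      ⟨r, Finset.mem_univ r, Real.rpow_pos_of_pos (div_pos hr hT) lam⟩
  have hβlam : 0 < β * lam := mul_pos hβ hlam0
  have hlog := Real.logb_le_logb_of_le one_lt_two (mul_pos hβlam hpos) hnormalized
  rw [Real.logb_mul hβlam.ne' hpos.ne'] at hlog
  have hinv : 1 / (lam - 1) = -(1 / (1 - lam)) := by
    rw [← neg_sub 1 lam, div_neg]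
  rw [hinv, neg_mul, ← sub_eq_add_neg, ← mul_sub]
  have : 0 < 1 - lam := sub_pos.2 hlam1
  gcongr
  linarith
end

section
/- Let G = (V, E) be a finite loopless undirected graph with nonnegative edge weights w and total weight W > 0, and let λ > 0 with λ ≠ 1. Then the minimum of H_λ(z/W) over all vectors z induced by fractional assignments of (G, w) equals the minimum of H_λ(q) over the indegree distributions q of all orientations of G. -/
open Finset in
/-- The loads `z i / W` of a fractional assignment sum to `1`. -/
lemma sum_normalized_load_eq_one {V : Type*} [Fintype V] (G : SimpleGraph V)
    [DecidableRel G.Adj] {w r : V → V → ℝ} {W : ℝ} (hsym : ∀ i j, w i j = w j i)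
    (hsupp : ∀ i j, ¬ G.Adj i j → w i j = 0) (hW : W = (∑ i, ∑ j, w i j) / 2) (hWpos : 0 < W)
    (hr : ∀ i j, G.Adj i j → r i j + r j i = 1) :
    ∑ i, (∑ j ∈ univ.filter (fun j => G.Adj i j), r i j * w i j) / W = 1 := by
  have hload : ∀ i, ∑ j ∈ univ.filter (fun j => G.Adj i j), r i j * w i j =
      ∑ j, r i j * w i j := by
    intro i
    refine sum_filter_of_ne fun j _ hj => ?_
    by_contra h
    exact hj (by rw [hsupp i j h, mul_zero])
  have hswap : ∑ i, ∑ j, r i j * w i j = ∑ i, ∑ j, r j i * w i j := by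
    rw [sum_comm]
    exact sum_congr rfl fun i _ => sum_congr rfl fun j _ => by rw [hsym]
  have hdouble : ∑ i, ∑ j, r i j * w i j + ∑ i, ∑ j, r j i * w i j = ∑ i, ∑ j, w i j := by
    simp only [← sum_add_distrib]
    refine sum_congr rfl fun i _ => sum_congr rfl fun j _ => ?_
    by_cases h : G.Adj i j
    · rw [← add_mul, hr i j h, one_mul]
    · simp [hsupp i j h]
  rw [← sum_div, sum_congr rfl fun i _ => hload i, div_eq_one_iff_eq hWpos.ne']
  linarith

lemma sum_rpow_pos_of_sum_pos {ι : Type*} [Fintype ι] {p : ι → ℝ} (hp : ∀ i, 0 ≤ p i)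
    (hsum : 0 < ∑ i, p i) (a : ℝ) : 0 < ∑ i, p i ^ a := by
  obtain ⟨i, hi, hpos⟩ := Finset.exists_lt_of_sum_lt (s := Finset.univ) (f := fun _ => (0 : ℝ))
    (g := p) (by simpa using hsum)
  exact Finset.sum_pos' (fun j _ => Real.rpow_nonneg (hp j) a) ⟨i, hi, Real.rpow_pos_of_pos hpos a⟩

open Finset in
/-- A convex separable function of the loads of a fractional assignment is bounded by its value
at some orientation, since the cube of assignments is the convex hull of its vertices. -/
lemma exists_orientation_sum_convex_ge {V : Type*} [Fintype V] [LinearOrder V]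
    (G : SimpleGraph V) [DecidableRel G.Adj] {w r : V → V → ℝ} {W : ℝ}
    (hnn : ∀ i j, 0 ≤ w i j) (hW : 0 ≤ W) {φ : ℝ → ℝ} (hφ : ConvexOn ℝ (Set.Ici 0) φ)
    (hr0 : ∀ i j, G.Adj i j → 0 ≤ r i j) (hr : ∀ i j, G.Adj i j → r i j + r j i = 1) :
    ∃ s : V → V → ℝ, (∀ i j, G.Adj i j → s i j = 0 ∨ s i j = 1) ∧
      (∀ i j, G.Adj i j → s i j + s j i = 1) ∧
      ∑ i, φ ((∑ j ∈ univ.filter (fun j => G.Adj i j), r i j * w i j) / W) ≤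
        ∑ i, φ ((∑ j ∈ univ.filter (fun j => G.Adj i j), s i j * w i j) / W) := by
  -- An assignment is parametrized by its values on the pairs `i < j`.
  let asg : (V × V → ℝ) → V → V → ℝ := fun x i j => if i < j then x (i, j) else 1 - x (j, i)
  let z : (V × V → ℝ) → V → ℝ := fun x i =>
    (∑ j ∈ univ.filter (fun j => G.Adj i j), asg x i j * w i j) / W
  have hz_affine : ∀ (x y : V × V → ℝ) (a b : ℝ), a + b = 1 → ∀ i,
      z (a • x + b • y) i = a • z x i + b • z y i := by
    intro x y a b hab i
    simp only [z, smul_eq_mul, ← mul_div_assoc, ← add_div, mul_sum, ← sum_add_distrib]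
    congr 1
    refine sum_congr rfl fun j _ => ?_
    simp only [asg, Pi.add_apply, Pi.smul_apply, smul_eq_mul]
    split_ifs
    · ring
    · linear_combination (-w i j) * hab
  have hcube : convexHull ℝ (Set.univ.pi fun _ : V × V => ({0, 1} : Set ℝ)) =
      Set.univ.pi fun _ => Set.Icc 0 1 := by
    simp only [convexHull_pi, convexHull_pair, segment_eq_Icc zero_le_one]
  have hz_nonneg : ∀ x ∈ Set.univ.pi (fun _ : V × V => Set.Icc (0 : ℝ) 1), ∀ i,
      z x i ∈ Set.Ici (0 : ℝ) := by
    intro x hx i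
    refine div_nonneg (sum_nonneg fun j _ => mul_nonneg ?_ (hnn i j)) hW
    simp only [asg]
    split_ifs
    · exact (hx (i, j) trivial).1
    · exact sub_nonneg.2 (hx (j, i) trivial).2
  have hconv : ConvexOn ℝ (convexHull ℝ (Set.univ.pi fun _ : V × V => ({0, 1} : Set ℝ)))
      (fun x => ∑ i, φ (z x i)) := by
    refine ⟨convex_convexHull ℝ _, fun x hx y hy a b ha hb hab => ?_⟩
    rw [hcube] at hx hy
    simp only [smul_sum, ← sum_add_distrib]
    refine sum_le_sum fun i _ => ?_
    rw [hz_affine x y a b hab i]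
    exact hφ.2 (hz_nonneg x hx i) (hz_nonneg y hy i) ha hb hab
  let x : V × V → ℝ := fun e => if G.Adj e.1 e.2 then r e.1 e.2 else 0
  have hx : x ∈ convexHull ℝ (Set.univ.pi fun _ : V × V => ({0, 1} : Set ℝ)) := by
    rw [hcube]
    rintro ⟨i, j⟩ -
    simp only [x]
    split_ifs with h
    · exact ⟨hr0 i j h, by linarith [hr i j h, hr0 j i h.symm]⟩
    · exact ⟨le_rfl, zero_le_one⟩
  have hasg : ∀ i j, G.Adj i j → asg x i j = r i j := by
    intro i j h
    simp only [asg, x, if_pos h, if_pos h.symm]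
    split_ifs
    · rfl
    · linarith [hr i j h]
  obtain ⟨y, hy, hle⟩ := hconv.exists_ge_of_mem_convexHull (subset_convexHull ℝ _) hx
  refine ⟨asg y, fun i j _ => ?_, fun i j h => ?_, ?_⟩
  · simp only [asg]
    split_ifs
    · exact hy (i, j) trivial
    · rcases hy (j, i) trivial with h | h <;> simp_all
  · rcases lt_or_gt_of_ne h.ne with hij | hij <;> simp [asg, hij, hij.not_gt]
  · refine le_trans (le_of_eq (sum_congr rfl fun i _ => ?_)) hle
    simp only [z]
    congr 2
    refine sum_congr rfl fun j hj => ?_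
    rw [hasg i j (mem_filter.1 hj).2]

/-- The minimum Rényi entropy over normalized vectors induced by fractional
assignments equals the minimum Rényi entropy over indegree distributions of
orientations (i.e., `{0,1}`-valued fractional assignments). -/
theorem fractional_min_eq_orientation_min
    (n : ℕ) (G : SimpleGraph (Fin n)) [DecidableRel G.Adj]
    (w : Fin n → Fin n → ℝ) (hsym : ∀ i j, w i j = w j i)
    (hnn : ∀ i j, 0 ≤ w i j) (hsupp : ∀ i j, ¬ G.Adj i j → w i j = 0)
    (W : ℝ) (hW : W = (∑ i, ∑ j, w i j) / 2) (hWpos : 0 < W)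
    (lam : ℝ) (hlam0 : 0 < lam) (hlam1 : lam ≠ 1) :
    sInf {x : ℝ | ∃ r : Fin n → Fin n → ℝ,
        (∀ i j, G.Adj i j → 0 ≤ r i j) ∧
        (∀ i j, G.Adj i j → r i j + r j i = 1) ∧
        x = (1 / (1 - lam)) * Real.logb 2
          (∑ i, ((∑ j ∈ Finset.univ.filter (fun j => G.Adj i j),
            r i j * w i j) / W) ^ lam)} =
    sInf {x : ℝ | ∃ r : Fin n → Fin n → ℝ,
        (∀ i j, G.Adj i j → r i j = 0 ∨ r i j = 1) ∧
        (∀ i j, G.Adj i j → r i j + r j i = 1) ∧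
        x = (1 / (1 - lam)) * Real.logb 2
          (∑ i, ((∑ j ∈ Finset.univ.filter (fun j => G.Adj i j),
            r i j * w i j) / W) ^ lam)} := by
  have hload : ∀ r : Fin n → Fin n → ℝ, (∀ i j, G.Adj i j → 0 ≤ r i j) → ∀ i,
      0 ≤ (∑ j ∈ Finset.univ.filter (fun j => G.Adj i j), r i j * w i j) / W :=
    fun r hr0 i => div_nonneg (Finset.sum_nonneg fun j hj =>
      mul_nonneg (hr0 i j (Finset.mem_filter.1 hj).2) (hnn i j)) hWpos.le
  have hpos : ∀ r : Fin n → Fin n → ℝ, (∀ i j, G.Adj i j → 0 ≤ r i j) →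
      (∀ i j, G.Adj i j → r i j + r j i = 1) →
      0 < ∑ i, ((∑ j ∈ Finset.univ.filter (fun j => G.Adj i j), r i j * w i j) / W) ^ lam :=
    fun r hr0 hr => sum_rpow_pos_of_sum_pos (hload r hr0)
      (by rw [sum_normalized_load_eq_one G hsym hsupp hW hWpos hr]; exact one_pos) lam
  have hnonneg : ∀ s : Fin n → Fin n → ℝ, (∀ i j, G.Adj i j → s i j = 0 ∨ s i j = 1) →
      ∀ i j, G.Adj i j → 0 ≤ s i j := by
    intro s hs i j h
    rcases hs i j h with h | h <;> simp [h]
  refine csInf_eq_csInf_of_forall_exists_le ?_ ?_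
  · rintro _ ⟨r, hr0, hr, rfl⟩
    rcases hlam1.lt_or_gt with hlt | hgt
    · obtain ⟨s, hs01, hs, hle⟩ := exists_orientation_sum_convex_ge G hnn hWpos.le
        (Real.concaveOn_rpow hlam0.le hlt.le).neg hr0 hr
      simp only [Pi.neg_apply, Finset.sum_neg_distrib, neg_le_neg_iff] at hle
      refine ⟨_, ⟨s, hs01, hs, rfl⟩, mul_le_mul_of_nonneg_left ?_ ?_⟩
      · exact Real.logb_le_logb_of_le one_lt_two (hpos s (hnonneg s hs01) hs) hle
      · exact one_div_nonneg.2 (sub_nonneg.2 hlt.le)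
    · obtain ⟨s, hs01, hs, hle⟩ := exists_orientation_sum_convex_ge G hnn hWpos.le
        (convexOn_rpow hgt.le) hr0 hr
      refine ⟨_, ⟨s, hs01, hs, rfl⟩, mul_le_mul_of_nonpos_left ?_ ?_⟩
      · exact Real.logb_le_logb_of_le one_lt_two (hpos r hr0 hr) hle
      · exact one_div_nonpos.2 (sub_nonpos.2 hgt.le)
  · rintro _ ⟨s, hs01, hs, rfl⟩
    exact ⟨_, ⟨s, hnonneg s hs01, hs, rfl⟩, le_rfl⟩
end

section
/- Let G = (V, E) be a finite loopless undirected graph with nonnegative edge weights w, total weight W = Σ_{e∈E} w_e > 0, and vertex weight v(i) = Σ_{e∋i} w_e assumed strictly positive for every vertex i. Let λ > 0 with λ ≠ 1. Then for every orientation h of G with indegree distribution q, H_λ(q) ≥ (1/(1−λ))·log₂( (1/W)·Σ_{{i,j}∈E} w_{{i,j}}·(max(v(i),v(j))/W)^{λ−1} ). -/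
/-- Symmetrization: weighting the two halves of a symmetric matrix by a symmetric kernel. -/
theorem sum_sum_mul_symm_eq_half {ι : Type*} [Fintype ι] (a m : ι → ι → ℝ)
    (hm : ∀ i j, m i j = m j i) :
    ∑ i, ∑ j, a i j * m i j = (∑ i, ∑ j, (a i j + a j i) * m i j) / 2 := by
  have h : ∑ i, ∑ j, a j i * m i j = ∑ i, ∑ j, a i j * m i j := by
    rw [Finset.sum_comm]
    exact Finset.sum_congr rfl fun i _ => Finset.sum_congr rfl fun j _ => by rw [hm j i]
  simp only [add_mul, Finset.sum_add_distrib, h]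
  ring

theorem Real.rpow_eq_mul_rpow_sub_one {x y : ℝ} (hx : 0 ≤ x) (hy : y ≠ 0) :
    x ^ y = x * x ^ (y - 1) := by
  rcases hx.eq_or_lt with rfl | hx
  · simp [Real.zero_rpow hy]
  · rw [Real.rpow_sub_one hx.ne']
    field_simp

/-- Lower bound on the Rényi entropy of the indegree distribution of any
orientation, in terms of the edge sum `Σ_{{i,j}∈E} w_{ij} (max(v(i),v(j))/W)^{λ-1}`
(the double sum is halved since each edge is counted twice). -/
theorem orientation_entropy_lower_bound
    (n : ℕ) (G : SimpleGraph (Fin n)) [DecidableRel G.Adj]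
    (w : Fin n → Fin n → ℝ) (hsym : ∀ i j, w i j = w j i)
    (hnn : ∀ i j, 0 ≤ w i j) (hsupp : ∀ i j, ¬ G.Adj i j → w i j = 0)
    (W : ℝ) (hW : W = (∑ i, ∑ j, w i j) / 2) (hWpos : 0 < W)
    (v : Fin n → ℝ) (hv : ∀ i, v i = ∑ j, w i j) (hvpos : ∀ i, 0 < v i)
    (lam : ℝ) (hlam0 : 0 < lam) (hlam1 : lam ≠ 1)
    (r : Fin n → Fin n → ℝ)
    (hr01 : ∀ i j, G.Adj i j → r i j = 0 ∨ r i j = 1)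
    (hr1 : ∀ i j, G.Adj i j → r i j + r j i = 1)
    (q : Fin n → ℝ)
    (hq : ∀ i, q i =
      (∑ j ∈ Finset.univ.filter (fun j => G.Adj i j), r i j * w i j) / W) :
    (1 / (1 - lam)) * Real.logb 2
        ((1 / W) * ((∑ i, ∑ j, w i j * (max (v i) (v j) / W) ^ (lam - 1)) / 2)) ≤
      (1 / (1 - lam)) * Real.logb 2 (∑ i, q i ^ lam) := by
  let a : Fin n → Fin n → ℝ := fun i j => if G.Adj i j then r i j * w i j else 0
  let m : Fin n → Fin n → ℝ := fun i j => (max (v i) (v j) / W) ^ (lam - 1)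
  have ha0 : ∀ i j, 0 ≤ a i j := by
    intro i j
    by_cases h : G.Adj i j
    · rcases hr01 i j h with h' | h' <;> simp [a, h, h', hnn i j]
    · simp [a, h]
  have haw : ∀ i j, a i j + a j i = w i j := by
    intro i j
    by_cases h : G.Adj i j
    · simp only [a, h, h.symm, if_true]
      rw [hsym j i, ← add_mul, hr1 i j h, one_mul]
    · have h' : ¬ G.Adj j i := fun h' => h h'.symm
      simp [a, h, h', hsupp i j h]
  have hqa : ∀ i, q i = (∑ j, a i j) / W := fun i => by
    rw [hq i, Finset.sum_filter]
  have hq0 : ∀ i, 0 ≤ q i := fun i => by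
    rw [hqa i]
    exact div_nonneg (Finset.sum_nonneg fun j _ => ha0 i j) hWpos.le
  have hqv : ∀ i, q i ≤ v i / W := fun i => by
    rw [hqa i, hv i]
    gcongr with j
    linarith [haw i j, ha0 j i]
  have haq : ∀ i j, 0 < a i j → 0 < q i := fun i j h => by
    rw [hqa i]
    exact div_pos (h.trans_le
      (Finset.single_le_sum (fun k _ => ha0 i k) (Finset.mem_univ j))) hWpos
  have hmsymm : ∀ i j, m i j = m j i := fun i j => by simp only [m, max_comm]
  have hqm : ∀ i j, q i ≤ max (v i) (v j) / W := fun i j =>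
    (hqv i).trans (by gcongr; exact le_max_left _ _)
  have hmpos : ∀ i j, 0 < m i j := fun i j =>
    Real.rpow_pos_of_pos (div_pos ((hvpos i).trans_le (le_max_left _ _)) hWpos) _
  have hedge : (1 / W) * ((∑ i, ∑ j, w i j * (max (v i) (v j) / W) ^ (lam - 1)) / 2) =
      (1 / W) * ∑ i, ∑ j, a i j * m i j := by
    rw [sum_sum_mul_symm_eq_half a m hmsymm]
    simp only [haw, m]
  have hpow : ∑ i, q i ^ lam = (1 / W) * ∑ i, ∑ j, a i j * q i ^ (lam - 1) := by
    rw [Finset.mul_sum]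
    refine Finset.sum_congr rfl fun i _ => ?_
    rw [Real.rpow_eq_mul_rpow_sub_one (hq0 i) hlam0.ne', ← Finset.sum_mul]
    nth_rewrite 1 [hqa i]
    ring
  have hWa : ∑ i, ∑ j, a i j = W := by
    have := sum_sum_mul_symm_eq_half a (fun _ _ => 1) (fun _ _ => rfl)
    simpa only [mul_one, haw, ← hW] using this
  obtain ⟨i₀, j₀, hij⟩ : ∃ i j, 0 < a i j := by
    by_contra! h
    have : ∑ i, ∑ j, a i j ≤ 0 :=
      Finset.sum_nonpos fun i _ => Finset.sum_nonpos fun j _ => h i j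
    linarith
  rw [hedge]
  rcases hlam1.lt_or_gt with hl | hl
  · refine mul_le_mul_of_nonneg_left (Real.logb_le_logb_of_le one_lt_two ?_ ?_)
      (one_div_nonneg.2 (by linarith))
    · refine mul_pos (one_div_pos.2 hWpos) ?_
      have hnonneg : ∀ i j, 0 ≤ a i j * m i j := fun i j => mul_nonneg (ha0 i j) (hmpos i j).le
      exact Finset.sum_pos' (fun i _ => Finset.sum_nonneg fun j _ => hnonneg i j)
        ⟨i₀, Finset.mem_univ _, Finset.sum_pos' (fun j _ => hnonneg i₀ j)
          ⟨j₀, Finset.mem_univ _, mul_pos hij (hmpos i₀ j₀)⟩⟩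
    · rw [hpow]
      refine mul_le_mul_of_nonneg_left (Finset.sum_le_sum fun i _ => Finset.sum_le_sum
        fun j _ => ?_) (one_div_nonneg.2 hWpos.le)
      rcases (ha0 i j).eq_or_lt with h | h
      · simp [← h]
      · exact mul_le_mul_of_nonneg_left
          (Real.rpow_le_rpow_of_nonpos (haq i j h) (hqm i j) (by linarith)) h.le
  · refine mul_le_mul_of_nonpos_left (Real.logb_le_logb_of_le one_lt_two ?_ ?_)
      (one_div_nonpos.2 (by linarith))
    · exact Finset.sum_pos' (fun i _ => Real.rpow_nonneg (hq0 i) _)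
        ⟨i₀, Finset.mem_univ _, Real.rpow_pos_of_pos (haq i₀ j₀ hij) _⟩
    · rw [hpow]
      exact mul_le_mul_of_nonneg_left (Finset.sum_le_sum fun i _ => Finset.sum_le_sum
        fun j _ => mul_le_mul_of_nonneg_left
          (Real.rpow_le_rpow (hq0 i) (hqm i j) (by linarith)) (ha0 i j))
        (one_div_nonneg.2 hWpos.le)
end

section
/- Let G = (V, E) be a finite loopless undirected graph with nonnegative edge weights w, total weight W > 0, and vertex weight v(i) = Σ_{e∋i} w_e strictly positive for every vertex i. Let λ > 0 with λ ≠ 1. Let OPT be the indegree distribution of an orientation of G of minimum Rényi entropy of order λ, let BI be the indegree distribution of any biased orientation of G, and let Sh be the Shapley distribution Sh_i = v(i)/(2W). Then H_λ(Sh) − H_λ(OPT) ≤ (1/λ)·[H_λ(Sh) − H_λ(BI)] + 1. -/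
/-- Hölder's inequality with exponents `1 / θ` and `1 / (1 - θ)`. -/
theorem sum_rpow_mul_rpow_one_sub_le {ι : Type*} (s : Finset ι) {a b : ι → ℝ} {θ : ℝ}
    (hθ0 : 0 < θ) (hθ1 : θ < 1) (ha : ∀ i, 0 ≤ a i) (hb : ∀ i, 0 ≤ b i) :
    ∑ i ∈ s, a i ^ θ * b i ^ (1 - θ) ≤ (∑ i ∈ s, a i) ^ θ * (∑ i ∈ s, b i) ^ (1 - θ) := by
  have h1 : 0 < 1 - θ := by linarith
  have hpq : (θ⁻¹).HolderConjugate (1 - θ)⁻¹ := by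
    rw [Real.holderConjugate_iff]
    exact ⟨(one_lt_inv₀ hθ0).2 hθ1, by simp⟩
  have h := Real.inner_le_Lp_mul_Lq_of_nonneg s hpq
    (f := fun i => a i ^ θ) (g := fun i => b i ^ (1 - θ))
    (fun i _ => Real.rpow_nonneg (ha i) _) (fun i _ => Real.rpow_nonneg (hb i) _)
  simpa [← Real.rpow_mul (ha _), ← Real.rpow_mul (hb _), hθ0.ne', h1.ne'] using h

/-- A sum over oriented edges, symmetrized over the two endpoints of each edge. -/
theorem sum_indegree_mul_eq {ι : Type*} [Fintype ι] (G : SimpleGraph ι) [DecidableRel G.Adj]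
    {w : ι → ι → ℝ} (hsym : ∀ i j, w i j = w j i) (hsupp : ∀ i j, ¬ G.Adj i j → w i j = 0)
    (r : ι → ι → ℝ) (f : ι → ℝ) :
    ∑ i, (∑ j ∈ Finset.univ.filter (fun j => G.Adj i j), r i j * w i j) * f i =
      (∑ i, ∑ j, w i j * (r i j * f i + r j i * f j)) / 2 := by
  have hfilter : ∀ i, ∑ j ∈ Finset.univ.filter (fun j => G.Adj i j), r i j * w i j =
      ∑ j, r i j * w i j := fun i =>
    Finset.sum_filter_of_ne fun j _ hne => by
      by_contra hadj
      exact hne (by rw [hsupp i j hadj, mul_zero])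
  have hswap : ∑ i, ∑ j, w i j * (r j i * f j) = ∑ i, ∑ j, w i j * (r i j * f i) := by
    rw [Finset.sum_comm]
    simp_rw [hsym]
  simp_rw [hfilter, mul_add, Finset.sum_add_distrib, hswap, Finset.sum_mul, add_self_div_two]
  exact Finset.sum_congr rfl fun i _ => Finset.sum_congr rfl fun j _ => by ring

/-- A biased orientation maximizes the indegree sum weighted by any function increasing with `v`. -/
theorem sum_indegree_mul_le_of_biased {ι : Type*} [Fintype ι] (G : SimpleGraph ι)
    [DecidableRel G.Adj] {w : ι → ι → ℝ} (hsym : ∀ i j, w i j = w j i)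
    (hnn : ∀ i j, 0 ≤ w i j) (hsupp : ∀ i j, ¬ G.Adj i j → w i j = 0) {v f : ι → ℝ}
    (hf : ∀ i j, v i ≤ v j → f i ≤ f j) {r b : ι → ι → ℝ}
    (hr01 : ∀ i j, G.Adj i j → r i j = 0 ∨ r i j = 1)
    (hr1 : ∀ i j, G.Adj i j → r i j + r j i = 1)
    (hb1 : ∀ i j, G.Adj i j → b i j + b j i = 1)
    (hbiased : ∀ i j, G.Adj i j → v j < v i → b i j = 1) :
    ∑ i, (∑ j ∈ Finset.univ.filter (fun j => G.Adj i j), r i j * w i j) * f i ≤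
      ∑ i, (∑ j ∈ Finset.univ.filter (fun j => G.Adj i j), b i j * w i j) * f i := by
  rw [sum_indegree_mul_eq G hsym hsupp, sum_indegree_mul_eq G hsym hsupp]
  refine div_le_div_of_nonneg_right
    (Finset.sum_le_sum fun i _ => Finset.sum_le_sum fun j _ => ?_) zero_le_two
  by_cases hadj : G.Adj i j
  · refine mul_le_mul_of_nonneg_left ?_ (hnn i j)
    have hr : r j i = 1 - r i j := by linarith [hr1 i j hadj]
    have hb : b j i = 1 - b i j := by linarith [hb1 i j hadj]
    rcases lt_trichotomy (v i) (v j) with hlt | heq | hgt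
    · have h1 := hbiased j i hadj.symm hlt
      have h2 := hf i j hlt.le
      have h3 : b i j = 0 := by linarith
      rcases hr01 i j hadj with h | h <;> rw [hr, h, h1, h3] <;> linarith
    · have h2 : f i = f j := le_antisymm (hf i j heq.le) (hf j i heq.ge)
      rw [hr, hb, h2]
      linarith
    · have h1 := hbiased i j hadj hgt
      have h2 := hf j i hgt.le
      rcases hr01 i j hadj with h | h <;> rw [hr, hb, h, h1] <;> linarith
  · simp [hsupp i j hadj]

/-- The comparison of Rényi entropies for distributions `q`, `b`, `s` with `q ≤ 2 s`, from the
comparison of the means of `s ^ (lam - 1)` under `q` and `b`. -/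
theorem renyi_entropy_sub_le {ι : Type*} [Fintype ι] {q b s : ι → ℝ}
    (hq0 : ∀ i, 0 ≤ q i) (hb0 : ∀ i, 0 ≤ b i) (hs0 : ∀ i, 0 < s i)
    (hq : 0 < ∑ i, q i) (hb : 0 < ∑ i, b i) (hqs : ∀ i, q i ≤ 2 * s i)
    {lam : ℝ} (hlam0 : 0 < lam) (hlam1 : lam ≠ 1)
    (hmax : 1 < lam → ∑ i, q i * s i ^ (lam - 1) ≤ ∑ i, b i * s i ^ (lam - 1))
    (hmin : lam < 1 → ∑ i, b i * s i ^ (lam - 1) ≤ ∑ i, q i * s i ^ (lam - 1)) :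
    (1 / (1 - lam)) * Real.logb 2 (∑ i, s i ^ lam)
        - (1 / (1 - lam)) * Real.logb 2 (∑ i, q i ^ lam) ≤
      (1 / lam) * ((1 / (1 - lam)) * Real.logb 2 (∑ i, s i ^ lam)
        - (1 / (1 - lam)) * Real.logb 2 (∑ i, b i ^ lam)) + 1 := by
  have sum_pos : ∀ p : ι → ℝ, (∀ i, 0 ≤ p i) → 0 < ∑ i, p i → 0 < ∑ i, p i ^ lam := by
    intro p hp0 hp
    obtain ⟨i, -, hi⟩ := Finset.exists_lt_of_sum_lt (s := Finset.univ) (f := fun _ => 0) (g := p) (by simpa using hp)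
    exact Finset.sum_pos' (fun j _ => Real.rpow_nonneg (hp0 j) _)
      ⟨i, Finset.mem_univ i, Real.rpow_pos_of_pos hi _⟩
  have hO := sum_pos q hq0 hq
  have hB := sum_pos b hb0 hb
  have hS := sum_pos s (fun i => (hs0 i).le) (by
    have h := Finset.sum_le_sum fun i (_ : i ∈ Finset.univ) => hqs i
    rw [← Finset.mul_sum] at h
    linarith)
  have hsplit : ∀ i, 0 < q i → q i ^ lam = q i * q i ^ (lam - 1) := fun i hi => by
    rw [Real.rpow_sub_one hi.ne', mul_div_cancel₀ _ hi.ne']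
  rcases lt_or_gt_of_ne hlam1 with hlt | hgt
  · have hpoint : 2 ^ (lam - 1) * ∑ i, q i * s i ^ (lam - 1) ≤ ∑ i, q i ^ lam := by
      rw [Finset.mul_sum]
      refine Finset.sum_le_sum fun i _ => ?_
      rcases (hq0 i).eq_or_lt with h | h
      · simp [← h, hlam0.ne']
      · rw [hsplit i h, mul_left_comm, ← Real.mul_rpow zero_le_two (hs0 i).le]
        exact mul_le_mul_of_nonneg_left
          (Real.rpow_le_rpow_of_nonpos h (hqs i) (by linarith)) h.le
    have hholder : ∑ i, b i ^ lam ≤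
        (∑ i, b i * s i ^ (lam - 1)) ^ lam * (∑ i, s i ^ lam) ^ (1 - lam) := by
      refine le_of_eq_of_le (Finset.sum_congr rfl fun i _ => ?_)
        (sum_rpow_mul_rpow_one_sub_le Finset.univ hlam0 hlt
          (fun i => mul_nonneg (hb0 i) (Real.rpow_nonneg (hs0 i).le _))
          (fun i => Real.rpow_nonneg (hs0 i).le lam))
      rw [Real.mul_rpow (hb0 i) (Real.rpow_nonneg (hs0 i).le _), ← Real.rpow_mul (hs0 i).le,
        ← Real.rpow_mul (hs0 i).le, mul_assoc, ← Real.rpow_add (hs0 i)]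
      ring_nf
      simp
    obtain ⟨M, hM⟩ : ∃ M, M = ∑ i, b i * s i ^ (lam - 1) := ⟨_, rfl⟩
    rw [← hM] at hholder
    have hM0 : 0 ≤ M := hM ▸ Finset.sum_nonneg fun i _ =>
      mul_nonneg (hb0 i) (Real.rpow_nonneg (hs0 i).le _)
    have hMpos : 0 < M := hM0.lt_of_ne' fun h => by
      rw [h, Real.zero_rpow hlam0.ne', zero_mul] at hholder
      linarith
    have hMO : 2 ^ (lam - 1) * M ≤ ∑ i, q i ^ lam :=
      (mul_le_mul_of_nonneg_left (hM ▸ hmin hlt) (by positivity)).trans hpoint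
    have h1 := Real.logb_le_logb_of_le one_lt_two hB hholder
    have h2 := Real.logb_le_logb_of_le one_lt_two (by positivity) hMO
    rw [Real.logb_mul (by positivity) (by positivity), Real.logb_rpow_eq_mul_logb_of_pos hMpos,
      Real.logb_rpow_eq_mul_logb_of_pos hS] at h1
    rw [Real.logb_mul (by positivity) (by positivity),
      Real.logb_rpow zero_lt_two (by norm_num)] at h2
    have hl : 0 < 1 - lam := by linarith
    rw [← sub_nonneg]
    have key := mul_le_mul_of_nonneg_left h2 hlam0.le
    refine (div_nonneg (sub_nonneg.2 (add_le_add h1 key)) (mul_pos hlam0 hl).le).trans_eq ?_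
    field_simp
    ring
  · have hpoint : ∑ i, q i ^ lam ≤ 2 ^ (lam - 1) * ∑ i, q i * s i ^ (lam - 1) := by
      rw [Finset.mul_sum]
      refine Finset.sum_le_sum fun i _ => ?_
      rcases (hq0 i).eq_or_lt with h | h
      · simp [← h, hlam0.ne']
      · rw [hsplit i h, mul_left_comm, ← Real.mul_rpow zero_le_two (hs0 i).le]
        exact mul_le_mul_of_nonneg_left
          (Real.rpow_le_rpow h.le (hqs i) (by linarith)) h.le
    have hholder : ∑ i, b i * s i ^ (lam - 1) ≤
        (∑ i, b i ^ lam) ^ lam⁻¹ * (∑ i, s i ^ lam) ^ (1 - lam⁻¹) := by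
      refine le_of_eq_of_le (Finset.sum_congr rfl fun i _ => ?_)
        (sum_rpow_mul_rpow_one_sub_le Finset.univ (inv_pos.2 hlam0) (inv_lt_one_of_one_lt₀ hgt)
          (fun i => Real.rpow_nonneg (hb0 i) lam)
          (fun i => Real.rpow_nonneg (hs0 i).le lam))
      rw [Real.rpow_rpow_inv (hb0 i) hlam0.ne', ← Real.rpow_mul (hs0 i).le, mul_sub,
        mul_inv_cancel₀ hlam0.ne', mul_one]
    have hle := hpoint.trans
      (mul_le_mul_of_nonneg_left ((hmax hgt).trans hholder) (by positivity))
    have h1 := Real.logb_le_logb_of_le one_lt_two hO hle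
    rw [Real.logb_mul (by positivity) (by positivity), Real.logb_mul (by positivity) (by positivity),
      Real.logb_rpow zero_lt_two (by norm_num), Real.logb_rpow_eq_mul_logb_of_pos hB,
      Real.logb_rpow_eq_mul_logb_of_pos hS] at h1
    have hl : 0 < lam - 1 := by linarith
    rw [← sub_nonneg]
    refine (div_nonneg (sub_nonneg.2 h1) hl.le).trans_eq ?_
    have hinv : 1 / (1 - lam) = -(1 / (lam - 1)) := by
      rw [← neg_sub lam 1, one_div_neg_eq_neg_one_div]
    rw [hinv]
    field_simp
    ring


/-- Comparison of the minimum-entropy orientation `OPT`, any biased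
orientation `BI`, and the Shapley distribution `Sh` of an induced subgraph
game: `H_λ(Sh) − H_λ(OPT) ≤ (1/λ)·[H_λ(Sh) − H_λ(BI)] + 1`. -/
theorem biased_orientation_entropy_bound
    (n : ℕ) (G : SimpleGraph (Fin n)) [DecidableRel G.Adj]
    (w : Fin n → Fin n → ℝ) (hsym : ∀ i j, w i j = w j i)
    (hnn : ∀ i j, 0 ≤ w i j) (hsupp : ∀ i j, ¬ G.Adj i j → w i j = 0)
    (W : ℝ) (hW : W = (∑ i, ∑ j, w i j) / 2) (hWpos : 0 < W)
    (v : Fin n → ℝ) (hv : ∀ i, v i = ∑ j, w i j) (hvpos : ∀ i, 0 < v i)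
    (lam : ℝ) (hlam0 : 0 < lam) (hlam1 : lam ≠ 1)
    -- the orientation OPT, of minimum Rényi entropy of order lam
    (ropt : Fin n → Fin n → ℝ)
    (hropt01 : ∀ i j, G.Adj i j → ropt i j = 0 ∨ ropt i j = 1)
    (hropt1 : ∀ i j, G.Adj i j → ropt i j + ropt j i = 1)
    (qopt : Fin n → ℝ)
    (hqopt : ∀ i, qopt i =
      (∑ j ∈ Finset.univ.filter (fun j => G.Adj i j), ropt i j * w i j) / W)
    (hoptmin : ∀ r' : Fin n → Fin n → ℝ,
      (∀ i j, G.Adj i j → r' i j = 0 ∨ r' i j = 1) →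
      (∀ i j, G.Adj i j → r' i j + r' j i = 1) →
      (1 / (1 - lam)) * Real.logb 2 (∑ i, qopt i ^ lam) ≤
        (1 / (1 - lam)) * Real.logb 2
          (∑ i, ((∑ j ∈ Finset.univ.filter (fun j => G.Adj i j),
            r' i j * w i j) / W) ^ lam))
    -- any biased orientation BI
    (rbi : Fin n → Fin n → ℝ)
    (hrbi01 : ∀ i j, G.Adj i j → rbi i j = 0 ∨ rbi i j = 1)
    (hrbi1 : ∀ i j, G.Adj i j → rbi i j + rbi j i = 1)
    (hbiased : ∀ i j, G.Adj i j → v j < v i → rbi i j = 1)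
    (qbi : Fin n → ℝ)
    (hqbi : ∀ i, qbi i =
      (∑ j ∈ Finset.univ.filter (fun j => G.Adj i j), rbi i j * w i j) / W)
    -- the Shapley distribution
    (Sh : Fin n → ℝ) (hSh : ∀ i, Sh i = v i / (2 * W)) :
    (1 / (1 - lam)) * Real.logb 2 (∑ i, Sh i ^ lam)
        - (1 / (1 - lam)) * Real.logb 2 (∑ i, qopt i ^ lam) ≤
      (1 / lam) * ((1 / (1 - lam)) * Real.logb 2 (∑ i, Sh i ^ lam)
        - (1 / (1 - lam)) * Real.logb 2 (∑ i, qbi i ^ lam)) + 1 := by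
  have hnonneg : ∀ r : Fin n → Fin n → ℝ, (∀ i j, G.Adj i j → r i j = 0 ∨ r i j = 1) → ∀ i,
      0 ≤ (∑ j ∈ Finset.univ.filter (fun j => G.Adj i j), r i j * w i j) / W := fun r hr i =>
    div_nonneg (Finset.sum_nonneg fun j hj => mul_nonneg
      (by rcases hr i j (Finset.mem_filter.1 hj).2 with h | h <;> simp [h]) (hnn i j)) hWpos.le
  have hsum : ∀ r : Fin n → Fin n → ℝ, (∀ i j, G.Adj i j → r i j + r j i = 1) →
      0 < ∑ i, (∑ j ∈ Finset.univ.filter (fun j => G.Adj i j), r i j * w i j) / W := by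
    intro r hr
    rw [← Finset.sum_div]
    refine div_pos ?_ hWpos
    have h := sum_indegree_mul_eq G hsym hsupp r fun _ => 1
    simp only [mul_one] at h
    rw [h]
    refine hWpos.trans_eq ?_
    rw [hW]
    congr 1
    refine Finset.sum_congr rfl fun i _ => Finset.sum_congr rfl fun j _ => ?_
    by_cases hadj : G.Adj i j
    · rw [hr i j hadj, mul_one]
    · simp [hsupp i j hadj]
  have hShpos : ∀ i, 0 < Sh i := fun i => by
    rw [hSh]
    exact div_pos (hvpos i) (by linarith)
  have hShmono : ∀ i j, v i ≤ v j → Sh i ≤ Sh j := fun i j hij => by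
    rw [hSh, hSh]
    gcongr
  refine renyi_entropy_sub_le (fun i => hqopt i ▸ hnonneg ropt hropt01 i)
    (fun i => hqbi i ▸ hnonneg rbi hrbi01 i) hShpos ?_ ?_ ?_ hlam0 hlam1 ?_ ?_
  · simpa only [hqopt] using hsum ropt hropt1
  · simpa only [hqbi] using hsum rbi hrbi1
  · intro i
    have h2 : 2 * Sh i = v i / W := by
      rw [hSh]
      field_simp
    rw [h2, hqopt, hv]
    refine div_le_div_of_nonneg_right ?_ hWpos.le
    refine (Finset.sum_le_sum fun j hj => ?_).trans
      (Finset.sum_le_univ_sum_of_nonneg fun j => hnn i j)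
    rcases hropt01 i j (Finset.mem_filter.1 hj).2 with h | h <;> simp [h, hnn i j]
  · intro hgt
    have h := sum_indegree_mul_le_of_biased G hsym hnn hsupp
      (f := fun i => Sh i ^ (lam - 1)) (v := v)
      (fun i j hij => Real.rpow_le_rpow (hShpos i).le (hShmono i j hij) (by linarith))
      hropt01 hropt1 hrbi1 hbiased
    simp_rw [hqopt, hqbi, div_mul_eq_mul_div, ← Finset.sum_div]
    exact div_le_div_of_nonneg_right h hWpos.le
  · intro hlt
    have h := sum_indegree_mul_le_of_biased G hsym hnn hsupp
      (f := fun i => -Sh i ^ (lam - 1)) (v := v)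
      (fun i j hij => neg_le_neg
        (Real.rpow_le_rpow_of_nonpos (hShpos i) (hShmono i j hij) (by linarith)))
      hropt01 hropt1 hrbi1 hbiased
    simp_rw [mul_neg, Finset.sum_neg_distrib, neg_le_neg_iff] at h
    simp_rw [hqopt, hqbi, div_mul_eq_mul_div, ← Finset.sum_div]
    exact div_le_div_of_nonneg_right h hWpos.le
end

section
/- Let G be a finite loopless undirected graph on vertices v_1, …, v_n with nonnegative integer edge weights w and total weight W > 0, where the ordering v_1, …, v_n is greedy, and let Δ be the associated greedy cover (so Σ_r Δ_r = W). Let λ > 0 with λ ≠ 1. Then for every integer cover x of (G, w), H_λ(Δ/W) ≤ H_λ(x/W) + (1/(λ−1))·log₂(λ). -/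
/-- If `g` is monotone on positive integers and every `e ∈ s` satisfies
`#{e' ∈ s | ρ e ≤ ρ e'} ≤ d e`, then `∑ g (d e)` is at least `g 1 + ⋯ + g #s`. -/
theorem sum_range_card_le_sum_of_card_le {ι α : Type*} [DecidableEq ι] [LinearOrder α]
    (g : ℕ → ℝ) (hg : ∀ a b, 0 < a → a ≤ b → g a ≤ g b) (ρ : ι → α) (d : ι → ℕ)
    (s : Finset ι) (h : ∀ e ∈ s, (s.filter (fun e' => ρ e ≤ ρ e')).card ≤ d e) :
    ∑ k ∈ Finset.range s.card, g (k + 1) ≤ ∑ e ∈ s, g (d e) := by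
  induction s using Finset.induction_on_min_value ρ with
  | empty => simp
  | insert a s ha hmin ih =>
    rw [Finset.card_insert_of_notMem ha, Finset.sum_range_succ, Finset.sum_insert ha, add_comm]
    refine add_le_add (hg _ _ (Nat.succ_pos _) ?_) (ih fun e he => ?_)
    · have hall : (insert a s).filter (fun e' => ρ a ≤ ρ e') = insert a s := by
        refine Finset.filter_true_of_mem fun e he => ?_
        rcases Finset.mem_insert.1 he with rfl | he
        · exact le_rfl
        · exact hmin e he
      have := h a (Finset.mem_insert_self a s)
      rwa [hall, Finset.card_insert_of_notMem ha] at this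
    · exact (Finset.card_le_card (Finset.filter_subset_filter _ (Finset.subset_insert a s))).trans
        (h e (Finset.mem_insert_of_mem he))

/-- The unit edges of a weighted graph: each pair `i < j` contributes `w i j` units. -/
abbrev UnitEdge {n : ℕ} (w : Fin n → Fin n → ℕ) : Type :=
  Σ p : Fin n × Fin n, Fin (if p.1 < p.2 then w p.1 p.2 else 0)

namespace UnitEdge

variable {n : ℕ} {w : Fin n → Fin n → ℕ}

theorem fst_lt_snd (e : UnitEdge w) : e.1.1 < e.1.2 := by
  by_contra h
  have := e.2.isLt
  simp [h] at this

theorem sum_comp_fst {M : Type*} [AddCommMonoid M] (f : Fin n × Fin n → M) :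
    ∑ e : UnitEdge w, f e.1 = ∑ i, ∑ j, if i < j then w i j • f (i, j) else 0 := by
  rw [Fintype.sum_sigma, Fintype.sum_prod_type]
  refine Finset.sum_congr rfl fun i _ => Finset.sum_congr rfl fun j _ => ?_
  split_ifs with h <;> simp [h]

theorem card_filter (P : Fin n × Fin n → Prop) [DecidablePred P] :
    (Finset.univ.filter (fun e : UnitEdge w => P e.1)).card =
      ∑ i, ∑ j, if i < j ∧ P (i, j) then w i j else 0 := by
  rw [Finset.card_filter, sum_comp_fst (fun p => if P p then 1 else 0)]
  refine Finset.sum_congr rfl fun i _ => Finset.sum_congr rfl fun j _ => ?_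
  by_cases h : i < j <;> by_cases h' : P (i, j) <;> simp [h, h']

/-- The unit edges incident to `v` inside the vertices from `r` onwards. -/
theorem card_incident_le (hsym : ∀ i j, w i j = w j i) (r v : Fin n) (hrv : r ≤ v) :
    (Finset.univ.filter
      (fun e : UnitEdge w => r ≤ e.1.1 ∧ (v = e.1.1 ∨ v = e.1.2))).card ≤
      ∑ t ∈ Finset.univ.filter (fun t => r ≤ t ∧ t ≠ v), w v t := by
  rw [card_filter (fun p => r ≤ p.1 ∧ (v = p.1 ∨ v = p.2))]
  have hsplit : ∀ i j : Fin n,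
      (if i < j ∧ r ≤ i ∧ (v = i ∨ v = j) then w i j else 0) =
        (if i = v then (if v < j then w v j else 0) else 0) +
          (if j = v then (if i < v ∧ r ≤ i then w v i else 0) else 0) := by
    intro i j
    have := hsym i j
    grind
  simp_rw [hsplit, Finset.sum_add_distrib]
  rw [Finset.sum_comm]
  simp only [Finset.sum_ite_eq', Finset.mem_univ, if_true]
  rw [← Finset.sum_add_distrib, Finset.sum_filter]
  refine Finset.sum_le_sum fun t _ => ?_
  grind

end UnitEdge

/-- An integer cover is realised by assigning each unit edge to one of its endpoints. -/
theorem exists_owner_of_cover {n : ℕ} (w : Fin n → Fin n → ℕ) (x : Fin n → ℕ)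
    (hxsum : ∑ i, x i = ∑ i, ∑ j ∈ Finset.univ.filter (fun j => i < j), w i j)
    (hxcover : ∀ S : Finset (Fin n),
      ∑ i ∈ S, ∑ j ∈ S.filter (fun j => i < j), w i j ≤ ∑ i ∈ S, x i) :
    ∃ owner : UnitEdge w → Fin n, (∀ e, owner e = e.1.1 ∨ owner e = e.1.2) ∧
      ∀ v, (Finset.univ.filter (fun e => owner e = v)).card = x v := by
  classical
  let t : UnitEdge w → Finset (Σ v : Fin n, Fin (x v)) :=
    fun e => Finset.univ.filter (fun c => c.1 = e.1.1 ∨ c.1 = e.1.2)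
  have hall : ∀ A : Finset (UnitEdge w), A.card ≤ (A.biUnion t).card := by
    intro A
    let S : Finset (Fin n) := A.image (fun e => e.1.1) ∪ A.image (fun e => e.1.2)
    have hA : A ⊆ Finset.univ.filter (fun e : UnitEdge w => e.1.1 ∈ S ∧ e.1.2 ∈ S) := by
      intro e he
      simp only [Finset.mem_filter, Finset.mem_univ, true_and, S, Finset.mem_union]
      exact ⟨Or.inl (Finset.mem_image_of_mem _ he), Or.inr (Finset.mem_image_of_mem _ he)⟩
    have hB : A.biUnion t = S.sigma (fun _ => Finset.univ) := by
      ext c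
      simp only [t, S, Finset.mem_biUnion, Finset.mem_filter, Finset.mem_univ, true_and,
        Finset.mem_sigma, and_true, Finset.mem_union, Finset.mem_image]
      grind
    refine (Finset.card_le_card hA).trans ?_
    rw [UnitEdge.card_filter (fun p => p.1 ∈ S ∧ p.2 ∈ S), hB, Finset.card_sigma]
    simp only [Finset.card_univ, Fintype.card_fin]
    refine le_trans (le_of_eq ?_) (hxcover S)
    rw [← Finset.sum_filter_add_sum_filter_not Finset.univ (· ∈ S)]
    rw [Finset.filter_mem_eq_inter, Finset.univ_inter, Finset.sum_eq_zero (s := Finset.filter _ _),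
      add_zero]
    · refine Finset.sum_congr rfl fun i hi => ?_
      rw [← Finset.sum_filter]
      refine Finset.sum_congr ?_ fun _ _ => rfl
      ext j
      simp [hi, and_comm]
    · intro i hi
      simp only [Finset.mem_filter, Finset.mem_univ, true_and] at hi
      simp [hi]
  obtain ⟨f, hinj, hf⟩ := (Finset.all_card_le_biUnion_card_iff_exists_injective t).1 hall
  have hcard : Fintype.card (UnitEdge w) = Fintype.card (Σ v : Fin n, Fin (x v)) := by
    have h := UnitEdge.card_filter (w := w) (fun _ => True)
    rw [Finset.filter_true, Finset.card_univ] at h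
    rw [h, Fintype.card_sigma]
    simp only [Fintype.card_fin, hxsum, and_true, Finset.sum_filter]
  have hbij : Function.Bijective f := (Fintype.bijective_iff_injective_and_card f).2 ⟨hinj, hcard⟩
  refine ⟨fun e => (f e).1, fun e => by simpa [t] using hf e, fun v => ?_⟩
  rw [Finset.card_filter, hbij.sum_comp (fun c => if c.1 = v then 1 else 0), Fintype.sum_sigma]
  simp [apply_ite Finset.card]

/-- The greedy cover dominates every integer cover for sums of discrete convex functions. -/
theorem sum_range_cover_le_sum_greedy {n : ℕ} (w : Fin n → Fin n → ℕ)
    (hsym : ∀ i j, w i j = w j i)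
    (hgreedy : ∀ r s : Fin n, r < s →
      ∑ t ∈ Finset.univ.filter (fun t => r ≤ t ∧ t ≠ s), w s t ≤
        ∑ t ∈ Finset.univ.filter (fun t => r < t), w r t)
    (Δ : Fin n → ℕ)
    (hΔ : ∀ r, Δ r = ∑ t ∈ Finset.univ.filter (fun t => r < t), w r t)
    (x : Fin n → ℕ)
    (hxsum : ∑ i, x i = ∑ i, ∑ j ∈ Finset.univ.filter (fun j => i < j), w i j)
    (hxcover : ∀ S : Finset (Fin n),
      ∑ i ∈ S, ∑ j ∈ S.filter (fun j => i < j), w i j ≤ ∑ i ∈ S, x i)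
    (g : ℕ → ℝ) (hg : ∀ a b, 0 < a → a ≤ b → g a ≤ g b) :
    ∑ v, ∑ k ∈ Finset.range (x v), g (k + 1) ≤ ∑ r, (Δ r : ℝ) * g (Δ r) := by
  classical
  obtain ⟨owner, hown, hcard⟩ := exists_owner_of_cover w x hxsum hxcover
  have hfiber : ∀ v, ∑ k ∈ Finset.range (x v), g (k + 1) ≤
      ∑ e ∈ Finset.univ.filter (fun e => owner e = v), g (Δ e.1.1) := by
    intro v
    rw [← hcard v]
    refine sum_range_card_le_sum_of_card_le g hg (fun e : UnitEdge w => e.1.1)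
      (fun e => Δ e.1.1) _ ?_
    intro e he
    obtain rfl := (Finset.mem_filter.1 he).2
    have hle : e.1.1 ≤ owner e := by
      rcases hown e with h | h <;> rw [h]
      exact e.fst_lt_snd.le
    have hsub : (Finset.univ.filter (fun e' => owner e' = owner e)).filter
        (fun e' => e.1.1 ≤ e'.1.1) ⊆ Finset.univ.filter
          (fun e' : UnitEdge w => e.1.1 ≤ e'.1.1 ∧ (owner e = e'.1.1 ∨ owner e = e'.1.2)) := by
      intro e' he'
      simp only [Finset.mem_filter, Finset.mem_univ, true_and] at he' ⊢
      exact ⟨he'.2, he'.1 ▸ hown e'⟩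
    refine (Finset.card_le_card hsub).trans
      ((UnitEdge.card_incident_le hsym _ _ hle).trans ?_)
    rw [hΔ]
    rcases hle.eq_or_lt with h | h
    · rw [← h]
      refine le_of_eq (Finset.sum_congr ?_ fun _ _ => rfl)
      ext t
      simp [lt_iff_le_and_ne, eq_comm]
    · exact hgreedy _ _ h
  calc ∑ v, ∑ k ∈ Finset.range (x v), g (k + 1)
      ≤ ∑ v, ∑ e ∈ Finset.univ.filter (fun e => owner e = v), g (Δ e.1.1) :=
        Finset.sum_le_sum fun v _ => hfiber v
    _ = ∑ e : UnitEdge w, g (Δ e.1.1) := Finset.sum_fiberwise _ _ _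
    _ = ∑ r, (Δ r : ℝ) * g (Δ r) := by
        rw [UnitEdge.sum_comp_fst (fun p => g (Δ p.1))]
        refine Finset.sum_congr rfl fun r _ => ?_
        dsimp only
        rw [← Finset.sum_filter, ← Finset.sum_smul, ← hΔ, nsmul_eq_mul]

theorem natCast_rpow_le_mul_sum_range {p : ℝ} (hp : 1 ≤ p) (m : ℕ) :
    (m : ℝ) ^ p ≤ p * ∑ k ∈ Finset.range m, ((k + 1 : ℕ) : ℝ) ^ (p - 1) := by
  induction m with
  | zero => simp [Real.zero_rpow (by linarith : p ≠ 0)]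
  | succ m ih =>
    rw [Finset.sum_range_succ, mul_add]
    have hpos : (0 : ℝ) < ((m + 1 : ℕ) : ℝ) := by positivity
    have hb := one_add_mul_self_le_rpow_one_add (s := -1 / ((m + 1 : ℕ) : ℝ)) (by
      rw [le_div_iff₀ hpos]; push_cast; linarith [(Nat.cast_nonneg m : (0 : ℝ) ≤ m)]) hp
    have hq : 1 + -1 / ((m + 1 : ℕ) : ℝ) = m / ((m + 1 : ℕ) : ℝ) := by
      field_simp; push_cast; ring
    rw [hq, Real.div_rpow (Nat.cast_nonneg m) hpos.le,
      le_div_iff₀ (Real.rpow_pos_of_pos hpos p)] at hb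
    rw [Real.rpow_sub_one hpos.ne']
    have : (1 + p * (-1 / ((m + 1 : ℕ) : ℝ))) * ((m + 1 : ℕ) : ℝ) ^ p =
      ((m + 1 : ℕ) : ℝ) ^ p - p * (((m + 1 : ℕ) : ℝ) ^ p / ((m + 1 : ℕ) : ℝ)) := by ring
    linarith

theorem mul_sum_range_le_natCast_rpow {p : ℝ} (hp0 : 0 < p) (hp1 : p ≤ 1) (m : ℕ) :
    p * ∑ k ∈ Finset.range m, ((k + 1 : ℕ) : ℝ) ^ (p - 1) ≤ (m : ℝ) ^ p := by
  induction m with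
  | zero => simp [Real.zero_rpow hp0.ne']
  | succ m ih =>
    rw [Finset.sum_range_succ, mul_add]
    have hpos : (0 : ℝ) < ((m + 1 : ℕ) : ℝ) := by positivity
    have hb := rpow_one_add_le_one_add_mul_self (s := -1 / ((m + 1 : ℕ) : ℝ)) (by
      rw [le_div_iff₀ hpos]; push_cast; linarith [(Nat.cast_nonneg m : (0 : ℝ) ≤ m)]) hp0.le hp1
    have hq : 1 + -1 / ((m + 1 : ℕ) : ℝ) = m / ((m + 1 : ℕ) : ℝ) := by
      field_simp; push_cast; ring
    rw [hq, Real.div_rpow (Nat.cast_nonneg m) hpos.le,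
      div_le_iff₀ (Real.rpow_pos_of_pos hpos p)] at hb
    rw [Real.rpow_sub_one hpos.ne']
    have : (1 + p * (-1 / ((m + 1 : ℕ) : ℝ))) * ((m + 1 : ℕ) : ℝ) ^ p =
      ((m + 1 : ℕ) : ℝ) ^ p - p * (((m + 1 : ℕ) : ℝ) ^ p / ((m + 1 : ℕ) : ℝ)) := by ring
    linarith

theorem natCast_mul_rpow_sub_one {p : ℝ} (hp : p ≠ 0) (m : ℕ) :
    (m : ℝ) * (m : ℝ) ^ (p - 1) = (m : ℝ) ^ p := by
  rcases Nat.eq_zero_or_pos m with rfl | hm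
  · simp [Real.zero_rpow hp]
  · have : (m : ℝ) ≠ 0 := by positivity
    rw [Real.rpow_sub_one this]
    field_simp

theorem sum_div_rpow_pos {ι : Type*} [Fintype ι] (y : ι → ℕ) {W : ℕ} (hW : 0 < W)
    (hy : ∑ i, y i = W) (p : ℝ) : 0 < ∑ i, ((y i : ℝ) / (W : ℝ)) ^ p := by
  obtain ⟨i, hi, hne⟩ := Finset.exists_ne_zero_of_sum_ne_zero (hy ▸ hW.ne' : ∑ i, y i ≠ 0)
  have : 0 < y i := Nat.pos_of_ne_zero hne
  exact Finset.sum_pos' (fun j _ => by positivity) ⟨i, hi, by positivity⟩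

theorem sum_div_rpow {ι : Type*} [Fintype ι] (y : ι → ℕ) (W : ℕ) (p : ℝ) :
    ∑ i, ((y i : ℝ) / (W : ℝ)) ^ p = (∑ i, (y i : ℝ) ^ p) / (W : ℝ) ^ p := by
  rw [Finset.sum_div]
  exact Finset.sum_congr rfl fun i _ => Real.div_rpow (Nat.cast_nonneg _) (Nat.cast_nonneg _) p


/-- Additive Rényi-entropy guarantee of the greedy cover for induced subgraph
games: `H_λ(Δ/W) ≤ H_λ(x/W) + (1/(λ−1))·log₂ λ` for every integer cover `x`. -/
theorem greedy_cover_renyi_bound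
    (n : ℕ) (w : Fin n → Fin n → ℕ)
    (hsym : ∀ i j, w i j = w j i) (hloop : ∀ i, w i i = 0)
    (W : ℕ)
    (hW : W = ∑ i, ∑ j ∈ Finset.univ.filter (fun j => i < j), w i j)
    (hWpos : 0 < W)
    (hgreedy : ∀ r s : Fin n, r < s →
      ∑ t ∈ Finset.univ.filter (fun t => r ≤ t ∧ t ≠ s), w s t ≤
        ∑ t ∈ Finset.univ.filter (fun t => r < t), w r t)
    (Δ : Fin n → ℕ)
    (hΔ : ∀ r, Δ r = ∑ t ∈ Finset.univ.filter (fun t => r < t), w r t)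
    (lam : ℝ) (hlam0 : 0 < lam) (hlam1 : lam ≠ 1)
    (x : Fin n → ℕ) (hxsum : ∑ i, x i = W)
    (hxcover : ∀ S : Finset (Fin n),
      ∑ i ∈ S, ∑ j ∈ S.filter (fun j => i < j), w i j ≤ ∑ i ∈ S, x i) :
    (1 / (1 - lam)) * Real.logb 2 (∑ r, ((Δ r : ℝ) / (W : ℝ)) ^ lam) ≤
      (1 / (1 - lam)) * Real.logb 2 (∑ j, ((x j : ℝ) / (W : ℝ)) ^ lam)
        + (1 / (lam - 1)) * Real.logb 2 lam := by
  have hA := sum_div_rpow_pos Δ hWpos (by simp only [hΔ, hW]) lam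
  have hB := sum_div_rpow_pos x hWpos hxsum lam
  have hdom := sum_range_cover_le_sum_greedy w hsym hgreedy Δ hΔ x (hxsum.trans hW) hxcover
  have hWp : (0 : ℝ) < (W : ℝ) ^ lam := by positivity
  rcases lt_or_gt_of_ne hlam1 with h1 | h1
  · have hsum := hdom (fun k => -(k : ℝ) ^ (lam - 1)) fun a b ha hab =>
      neg_le_neg (Real.rpow_le_rpow_of_nonpos (by positivity) (by exact_mod_cast hab)
        (by linarith))
    simp only [mul_neg, Finset.sum_neg_distrib, neg_le_neg_iff,
      natCast_mul_rpow_sub_one hlam0.ne'] at hsum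
    have hx : lam * ∑ r, (Δ r : ℝ) ^ lam ≤ ∑ j, (x j : ℝ) ^ lam := by
      refine (mul_le_mul_of_nonneg_left hsum hlam0.le).trans ?_
      rw [Finset.mul_sum]
      exact Finset.sum_le_sum fun j _ => mul_sum_range_le_natCast_rpow hlam0 h1.le (x j)
    have hle : lam * ∑ r, ((Δ r : ℝ) / (W : ℝ)) ^ lam ≤ ∑ j, ((x j : ℝ) / (W : ℝ)) ^ lam := by
      rw [sum_div_rpow, sum_div_rpow, ← mul_div_assoc]
      exact div_le_div_of_nonneg_right hx hWp.le
    have hlog := Real.logb_le_logb_of_le (b := 2) one_lt_two (by positivity) hle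
    rw [Real.logb_mul hlam0.ne' hA.ne'] at hlog
    have hc : 0 ≤ 1 / (1 - lam) := by
      have : 0 < 1 - lam := by linarith
      positivity
    have hneg : 1 / (lam - 1) = -(1 / (1 - lam)) := by
      rw [← neg_sub 1 lam, one_div_neg_eq_neg_one_div]
    rw [hneg]
    nlinarith [mul_le_mul_of_nonneg_left hlog hc]
  · have hsum := hdom (fun k => (k : ℝ) ^ (lam - 1)) fun a b ha hab =>
      Real.rpow_le_rpow (by positivity) (by exact_mod_cast hab) (by linarith)
    simp only [natCast_mul_rpow_sub_one hlam0.ne'] at hsum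
    have hx : ∑ j, (x j : ℝ) ^ lam ≤ lam * ∑ r, (Δ r : ℝ) ^ lam := by
      refine le_trans ?_ (mul_le_mul_of_nonneg_left hsum hlam0.le)
      rw [Finset.mul_sum]
      exact Finset.sum_le_sum fun j _ => natCast_rpow_le_mul_sum_range h1.le (x j)
    have hle : ∑ j, ((x j : ℝ) / (W : ℝ)) ^ lam ≤ lam * ∑ r, ((Δ r : ℝ) / (W : ℝ)) ^ lam := by
      rw [sum_div_rpow, sum_div_rpow, ← mul_div_assoc]
      exact div_le_div_of_nonneg_right hx hWp.le
    have hlog := Real.logb_le_logb_of_le (b := 2) one_lt_two hB hle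
    rw [Real.logb_mul hlam0.ne' hA.ne'] at hlog
    have hc : 0 ≤ 1 / (lam - 1) := by
      have : 0 < lam - 1 := by linarith
      positivity
    have hneg : 1 / (1 - lam) = -(1 / (lam - 1)) := by
      rw [← neg_sub lam 1, one_div_neg_eq_neg_one_div]
    rw [hneg]
    nlinarith [mul_le_mul_of_nonneg_left hlog hc]
end
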